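/- (Comparison of maxima with the one-dimensional model) Let n ≥ 1, let Ω ⊂ ℝⁿ be a nonempty bounded open convex set with smooth boundary, let F be a strongly convex Minkowski norm of class C³ on ℝⁿ∖{0}, let λ > 0, and let u be a nonconstant Neumann eigenfunction of the Finsler–Laplacian on Ω with eigenvalue λ, ∫_Ω u dx = 0, normalized so that min_{closure(Ω)} u = −1. Let b > 0 and let v : [0,b] → ℝ be continuous, C² on (0,b), satisfying v''(t) + ((n−1)/t) v'(t) + λ v(t) = 0 on (0,b), v(0) = −1, v'(0⁺) = 0, v' > 0 on (0,b), and v'(b) = 0. Then max_{closure(Ω)} u ≥ v(b). -/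

import Mathlib

open Real
open scoped RealInnerProductSpace

noncomputable section

/-- The `i`-th partial derivative of `f : ℝⁿ → ℝ` at `x`. -/
def pd {n : ℕ} (f : EuclideanSpace ℝ (Fin n) → ℝ) (i : Fin n)
    (x : EuclideanSpace ℝ (Fin n)) : ℝ :=
  fderiv ℝ f x (EuclideanSpace.single i 1)

/-- `a_{ij}(ξ) = ∂²(½F²)/∂ξ_i∂ξ_j (ξ)`. -/
def aCoeff {n : ℕ} (F : EuclideanSpace ℝ (Fin n) → ℝ) (i j : Fin n)
    (ξ : EuclideanSpace ℝ (Fin n)) : ℝ :=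
  pd (pd (fun η => F η ^ 2 / 2) i) j ξ

/-- A Minkowski norm on ℝⁿ: nonnegative, convex, even, positively 1-homogeneous,
and positive away from the origin. -/
structure IsMinkowskiNorm {n : ℕ} (F : EuclideanSpace ℝ (Fin n) → ℝ) : Prop where
  nonneg : ∀ ξ, 0 ≤ F ξ
  convexOn : ConvexOn ℝ Set.univ F
  even : ∀ ξ, F (-ξ) = F ξ
  homog : ∀ (t : ℝ) (ξ : EuclideanSpace ℝ (Fin n)), F (t • ξ) = |t| * F ξ
  pos : ∀ ξ, ξ ≠ 0 → 0 < F ξ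

/-- A strongly convex Minkowski norm of class C³: additionally `F` is C³ away from
the origin and the Hessian of `F²` is positive definite away from the origin. -/
structure IsStronglyConvexMinkowskiNormC3 {n : ℕ}
    (F : EuclideanSpace ℝ (Fin n) → ℝ) extends IsMinkowskiNorm F : Prop where
  contDiff3 : ContDiffOn ℝ 3 F {(0 : EuclideanSpace ℝ (Fin n))}ᶜ
  posDef : ∀ ξ : EuclideanSpace ℝ (Fin n), ξ ≠ 0 →
    ∀ V : EuclideanSpace ℝ (Fin n), V ≠ 0 →
      0 < ∑ i, ∑ j, aCoeff F i j ξ * V i * V j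

/-- A set has smooth boundary: near each boundary point there is a smooth local defining
function with nonvanishing differential. -/
def HasSmoothBoundary {n : ℕ} (Ω : Set (EuclideanSpace ℝ (Fin n))) : Prop :=
  ∀ x ∈ frontier Ω, ∃ U ∈ nhds x, ∃ f : EuclideanSpace ℝ (Fin n) → ℝ,
    ContDiff ℝ (⊤ : ℕ∞) f ∧ (∀ y ∈ U, (y ∈ Ω ↔ f y < 0)) ∧
      ∀ y ∈ U, y ∈ frontier Ω → fderiv ℝ f y ≠ 0

/-- `u` is a Neumann eigenfunction of the Finsler–Laplacian on `Ω` with eigenvalue `lam`: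
`u` is C¹ on the closure, C² where the gradient does not vanish, solves
`Σ a_{ij}(∇u) u_{ij} = −λ u` there, `F(∇u)F_ξ(∇u)` is continuous, and the anisotropic
Neumann condition `⟨F_ξ(∇u), ν⟩ = 0` holds at boundary points with `∇u ≠ 0`, for any
outward normal `ν` of the convex body `closure Ω`. -/
structure IsNeumannEigenfunction {n : ℕ} (F : EuclideanSpace ℝ (Fin n) → ℝ)
    (Ω : Set (EuclideanSpace ℝ (Fin n))) (lam : ℝ)
    (u : EuclideanSpace ℝ (Fin n) → ℝ) : Prop where
  contDiff1 : ContDiffOn ℝ 1 u (closure Ω)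
  contDiff2 : ContDiffOn ℝ 2 u {x ∈ closure Ω | gradient u x ≠ 0}
  eqn : ∀ x ∈ Ω, gradient u x ≠ 0 →
    ∑ i, ∑ j, aCoeff F i j (gradient u x) * pd (pd u i) j x = -lam * u x
  fluxCont : ContinuousOn
    (fun x => F (gradient u x) • gradient F (gradient u x)) (closure Ω)
  neumann : ∀ x ∈ frontier Ω, gradient u x ≠ 0 →
    ∀ ν : EuclideanSpace ℝ (Fin n), ν ≠ 0 →
      (∀ y ∈ closure Ω, ⟪ν, y - x⟫ ≤ 0) →
      ⟪gradient F (gradient u x), ν⟫ = 0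

section Auxiliary

open Filter Topology Set

/-- The coefficients of the power series in `t = s²` of the regular solution of
`V'' + ((N-1)/s) V' + lam V = 0`, `V(0) = -1`. -/
def modelCoeff (lam N : ℝ) : ℕ → ℝ
  | 0 => -1
  | k + 1 => -lam / (2 * (k + 1) * (N + 2 * k)) * modelCoeff lam N k

def modelSeries (lam N t : ℝ) : ℝ := ∑' k, modelCoeff lam N k * t ^ k

/-- The regular solution of `V'' + ((N-1)/s) V' + lam V = 0`, `V(0) = -1`. -/
def modelSol (lam N s : ℝ) : ℝ := modelSeries lam N (s ^ 2)

lemma abs_modelCoeff_le {lam N : ℝ} (hN : 1 ≤ N) (k : ℕ) :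
    |modelCoeff lam N k| ≤ (|lam| / 2) ^ k / k.factorial := by
  induction k with
  | zero => simp [modelCoeff]
  | succ k ih =>
    have hk : (0 : ℝ) ≤ k := Nat.cast_nonneg k
    rw [modelCoeff, abs_mul, abs_div, abs_neg,
      abs_of_pos (by positivity : 0 < 2 * (k + 1) * (N + 2 * k))]
    calc |lam| / (2 * (k + 1) * (N + 2 * k)) * |modelCoeff lam N k|
        ≤ |lam| / (2 * (k + 1)) * ((|lam| / 2) ^ k / k.factorial) := by
          refine mul_le_mul ?_ ih (abs_nonneg _) (by positivity)
          exact div_le_div_of_nonneg_left (abs_nonneg _) (by positivity) (by nlinarith)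
      _ = (|lam| / 2) ^ (k + 1) / (k + 1).factorial := by
          rw [Nat.factorial_succ]
          push_cast
          field_simp
          ring

lemma modelCoeff_shift {lam N : ℝ} (hN : 1 ≤ N) (k : ℕ) :
    N * modelCoeff lam N k = (N + 2 * k) * modelCoeff lam (N + 2) k := by
  induction k with
  | zero => simp [modelCoeff]
  | succ k ih =>
    have hk : (0 : ℝ) ≤ k := Nat.cast_nonneg k
    have h1 : N + 2 * k ≠ 0 := by positivity
    have h2 : N + 2 + 2 * k ≠ 0 := by positivity
    simp only [modelCoeff]
    push_cast
    field_simp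
    linear_combination (-lam * (N + 2 + 2 * k)) * ih

lemma modelCoeff_succ_mul {lam N : ℝ} (hN : 1 ≤ N) (k : ℕ) :
    modelCoeff lam N (k + 1) * (k + 1) = -lam / (2 * N) * modelCoeff lam (N + 2) k := by
  have hk : (0 : ℝ) ≤ k := Nat.cast_nonneg k
  have h1 : N + 2 * k ≠ 0 := by positivity
  have := modelCoeff_shift (lam := lam) hN k
  simp only [modelCoeff]
  field_simp
  linear_combination (-lam) * this

lemma summable_modelBound (lam R : ℝ) :
    Summable fun k : ℕ => (|lam| / 2) ^ k / k.factorial * R ^ k := by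
  refine (Real.summable_pow_div_factorial (|lam| / 2 * R)).congr fun k => ?_
  rw [mul_pow]
  ring

lemma continuousOn_modelSeries (lam R : ℝ) :
    ContinuousOn (fun q : ℝ × ℝ => modelSeries lam q.1 q.2) (Ici 1 ×ˢ Icc (-R) R) := by
  refine continuousOn_tsum (fun k => ?_) (summable_modelBound lam R) ?_
  · refine ContinuousOn.mul ?_ (by fun_prop)
    induction k with
    | zero => exact continuousOn_const
    | succ k ih =>
      refine ContinuousOn.mul (ContinuousOn.div (by fun_prop) (by fun_prop) ?_) ih
      rintro ⟨N, t⟩ ⟨hN, -⟩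
      have : (1 : ℝ) ≤ N := hN
      positivity
  · rintro k ⟨N, t⟩ ⟨hN, ht⟩
    rw [norm_mul, norm_pow]
    exact mul_le_mul (abs_modelCoeff_le hN k)
      (pow_le_pow_left₀ (norm_nonneg _) (abs_le.2 ht) k) (by positivity) (by positivity)

lemma hasDerivAt_modelSeries {lam N : ℝ} (hN : 1 ≤ N) (t : ℝ) :
    HasDerivAt (modelSeries lam N) (-lam / (2 * N) * modelSeries lam (N + 2) t) t := by
  set R := |t| + 1
  have hR : 0 < R := by positivity
  have hsum : Summable fun k : ℕ => (|lam| / 2) ^ k / k.factorial * (k * R ^ (k - 1)) := by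
    rw [← summable_nat_add_iff 1]
    refine ((summable_modelBound lam R).mul_left (|lam| / 2)).congr fun k => ?_
    rw [Nat.factorial_succ]
    push_cast
    have h4 : (k : ℝ) + 1 ≠ 0 := by positivity
    field_simp
    ring
  have hs0 : Summable fun k => modelCoeff lam N k * t ^ k := by
    refine Summable.of_norm_bounded (summable_modelBound lam |t|) fun k => ?_
    rw [norm_mul, norm_pow]
    exact mul_le_mul_of_nonneg_right (abs_modelCoeff_le hN k) (by positivity)
  have hbd : ∀ (k : ℕ) (s : ℝ), s ∈ Ioo (-R) R → ‖modelCoeff lam N k * (k * s ^ (k - 1))‖ ≤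
      (|lam| / 2) ^ k / k.factorial * (k * R ^ (k - 1)) := by
    intro k s hs
    rw [norm_mul, norm_mul, norm_pow, Real.norm_natCast]
    refine mul_le_mul (abs_modelCoeff_le hN k) ?_ (by positivity) (by positivity)
    exact mul_le_mul_of_nonneg_left
      (pow_le_pow_left₀ (norm_nonneg _) (abs_le.2 ⟨hs.1.le, hs.2.le⟩) _) (by positivity)
  have htR : t ∈ Ioo (-R) R :=
    ⟨by linarith [neg_abs_le t, show R = |t| + 1 from rfl],
      by linarith [le_abs_self t, show R = |t| + 1 from rfl]⟩
  have key := hasDerivAt_tsum_of_isPreconnected (t := Ioo (-R) R)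
    (g := fun k s => modelCoeff lam N k * s ^ k)
    (g' := fun k s => modelCoeff lam N k * (k * s ^ (k - 1))) hsum isOpen_Ioo isPreconnected_Ioo
    (fun k s _ => (hasDerivAt_pow k s).const_mul _) hbd htR hs0 htR
  refine key.congr_deriv ?_
  have hs1 : Summable fun k : ℕ => modelCoeff lam N k * (k * t ^ (k - 1)) :=
    Summable.of_norm_bounded hsum fun k => hbd k t htR
  rw [hs1.tsum_eq_zero_add, modelSeries, ← tsum_mul_left]
  simp only [Nat.cast_zero, zero_mul, mul_zero, zero_add]
  refine tsum_congr fun k => ?_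
  have := modelCoeff_succ_mul (lam := lam) hN k
  push_cast
  linear_combination t ^ k * this

lemma modelSeries_zero (lam N : ℝ) : modelSeries lam N 0 = -1 := by
  rw [modelSeries, tsum_eq_single 0]
  · simp [modelCoeff]
  · intro k hk
    simp [hk]

lemma modelSol_zero (lam N : ℝ) : modelSol lam N 0 = -1 := by
  simp [modelSol, modelSeries_zero]

/-- The three-term relation equivalent to the differential equation. -/
lemma modelSeries_recurrence {lam N : ℝ} (hN : 1 ≤ N) (t : ℝ) :
    lam * t / (N * (N + 2)) * modelSeries lam (N + 4) t - modelSeries lam (N + 2) t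
      + modelSeries lam N t = 0 := by
  have hs : ∀ M : ℝ, 1 ≤ M → Summable fun k => modelCoeff lam M k * t ^ k := by
    intro M hM
    refine Summable.of_norm_bounded (summable_modelBound lam |t|) fun k => ?_
    rw [norm_mul, norm_pow]
    exact mul_le_mul_of_nonneg_right (abs_modelCoeff_le hM k) (by positivity)
  have h0 := hs N hN
  have h2 := hs (N + 2) (by linarith)
  have h4 := hs (N + 4) (by linarith)
  have hd := h2.sub h0
  have : ∑' k, (modelCoeff lam (N + 2) k * t ^ k - modelCoeff lam N k * t ^ k) =
      lam * t / (N * (N + 2)) * modelSeries lam (N + 4) t := by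
    rw [hd.tsum_eq_zero_add, modelSeries, ← tsum_mul_left]
    simp only [show ∀ M, modelCoeff lam M 0 = -1 from fun _ => rfl, sub_self, zero_add, pow_zero]
    refine tsum_congr fun k => ?_
    have e1 := modelCoeff_shift (lam := lam) hN (k + 1)
    have e2 := modelCoeff_succ_mul (lam := lam) (N := N + 2) (by linarith) k
    rw [show N + 2 + 2 = N + 4 by ring] at e2
    have hN0 : N ≠ 0 := by positivity
    have hN2 : N + 2 ≠ 0 := by positivity
    push_cast at e1
    field_simp at e2 ⊢
    linear_combination (-t * t ^ k * (N + 2)) * e1 - t * t ^ k * e2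
  rw [Summable.tsum_sub h2 h0] at this
  change modelSeries lam (N + 2) t - modelSeries lam N t = _ at this
  linarith

/-- The derivative of `modelSol`. -/
def modelDeriv (lam N s : ℝ) : ℝ := -lam / N * s * modelSol lam (N + 2) s

lemma hasDerivAt_modelSol {lam N : ℝ} (hN : 1 ≤ N) (s : ℝ) :
    HasDerivAt (modelSol lam N) (modelDeriv lam N s) s := by
  have := (hasDerivAt_modelSeries (lam := lam) hN (s ^ 2)).comp s (hasDerivAt_pow 2 s)
  refine this.congr_deriv ?_
  simp only [modelDeriv, modelSol]
  have : N ≠ 0 := by positivity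
  field_simp
  push_cast
  ring

/-- The second derivative of `modelSol`, read off from its differential equation. -/
lemma hasDerivAt_modelDeriv {lam N : ℝ} (hN : 1 ≤ N) {s : ℝ} (hs : s ≠ 0) :
    HasDerivAt (modelDeriv lam N)
      (-((N - 1) / s * modelDeriv lam N s) - lam * modelSol lam N s) s := by
  have h := ((hasDerivAt_id s).const_mul (-lam / N)).mul
    (hasDerivAt_modelSol (lam := lam) (N := N + 2) (by linarith) s)
  refine h.congr_deriv ?_
  have hr := modelSeries_recurrence (lam := lam) hN (s ^ 2)
  simp only [modelDeriv, modelSol, id] at hr ⊢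
  rw [show N + 2 + 2 = N + 4 by ring]
  have : N ≠ 0 := by positivity
  have : N + 2 ≠ 0 := by positivity
  field_simp at hr ⊢
  linear_combination lam * hr

lemma continuous_modelSol {lam N : ℝ} (hN : 1 ≤ N) : Continuous (modelSol lam N) :=
  continuous_iff_continuousAt.2 fun s => (hasDerivAt_modelSol hN s).continuousAt

lemma continuous_modelDeriv {lam N : ℝ} (hN : 1 ≤ N) : Continuous (modelDeriv lam N) :=
  (continuous_const.mul continuous_id).mul (continuous_modelSol (by linarith))

/-- A solution of the model equation with the initial values of `modelSol` equals it. -/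
lemma eq_modelSol {n : ℕ} (hn : 1 ≤ n) {lam : ℝ} (hlam : 0 < lam) {b : ℝ} (hb : 0 < b) {v : ℝ → ℝ}
    (hvcont : ContinuousOn v (Icc 0 b)) (hvC2 : ContDiffOn ℝ 2 v (Ioo 0 b))
    (hode : ∀ t ∈ Ioo 0 b,
      deriv (deriv v) t + (((n : ℝ) - 1) / t) * deriv v t + lam * v t = 0)
    (hv0 : v 0 = -1) (hv'0 : Tendsto (deriv v) (𝓝[>] 0) (𝓝 0)) :
    EqOn v (modelSol lam n) (Ioo 0 b) := by
  have hn1 : (1 : ℝ) ≤ n := by exact_mod_cast hn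
  have hd1 : ∀ t ∈ Ioo 0 b, HasDerivAt v (deriv v t) t := fun t ht =>
    ((hvC2.differentiableOn (by norm_num)).differentiableAt (isOpen_Ioo.mem_nhds ht)).hasDerivAt
  have hd2 : ∀ t ∈ Ioo 0 b, HasDerivAt (deriv v) (deriv (deriv v) t) t := fun t ht =>
    (((hvC2.deriv_of_isOpen isOpen_Ioo (m := 1) (by norm_num)).differentiableOn
      (by norm_num)).differentiableAt (isOpen_Ioo.mem_nhds ht)).hasDerivAt
  let E : ℝ → ℝ := fun t =>
    (deriv v t - modelDeriv lam n t) ^ 2 + lam * (v t - modelSol lam n t) ^ 2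
  have hE : ∀ t ∈ Ioo 0 b,
      HasDerivAt E (-(2 * ((n - 1) / t) * (deriv v t - modelDeriv lam n t) ^ 2)) t := by
    intro t ht
    have h1 := (((hd2 t ht).sub (hasDerivAt_modelDeriv (lam := lam) hn1 ht.1.ne')).pow 2).add
      ((((hd1 t ht).sub (hasDerivAt_modelSol (lam := lam) hn1 t)).pow 2).const_mul lam)
    refine h1.congr_deriv ?_
    have h2 : deriv (deriv v) t = -(((n : ℝ) - 1) / t) * deriv v t - lam * v t := by
      linarith [hode t ht]
    simp only [Pi.sub_apply]
    rw [h2]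
    push_cast
    ring
  have hanti : AntitoneOn E (Ioo 0 b) := by
    refine antitoneOn_of_deriv_nonpos (convex_Ioo 0 b)
      (fun t ht => (hE t ht).continuousAt.continuousWithinAt) ?_ ?_
    · rw [interior_Ioo]
      exact fun t ht => (hE t ht).differentiableAt.differentiableWithinAt
    · rw [interior_Ioo]
      intro t ht
      rw [(hE t ht).deriv]
      have : 0 ≤ ((n : ℝ) - 1) / t := div_nonneg (by linarith) ht.1.le
      have := mul_nonneg this (sq_nonneg (deriv v t - modelDeriv lam n t))
      linarith
  have hlim : Tendsto E (𝓝[>] 0) (𝓝 0) := by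
    have h1 : Tendsto (modelDeriv lam n) (𝓝[>] 0) (𝓝 0) := by
      have := ((continuous_modelDeriv (lam := lam) hn1).tendsto 0).mono_left
        (nhdsWithin_le_nhds (s := Ioi 0))
      simpa [modelDeriv] using this
    have h2 : Tendsto (modelSol lam n) (𝓝[>] 0) (𝓝 (-1)) := by
      have := ((continuous_modelSol (lam := lam) hn1).tendsto 0).mono_left
        (nhdsWithin_le_nhds (s := Ioi 0))
      simpa [modelSol_zero] using this
    have h3 : Tendsto v (𝓝[>] 0) (𝓝 (-1)) := by
      rw [← hv0, ← nhdsWithin_Ioo_eq_nhdsGT hb]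
      exact (hvcont 0 ⟨le_rfl, hb.le⟩).mono Ioo_subset_Icc_self
    simpa using ((hv'0.sub h1).pow 2).add (((h3.sub h2).pow 2).const_mul lam)
  intro t ht
  have hle : E t ≤ 0 := by
    refine ge_of_tendsto hlim ?_
    filter_upwards [Ioo_mem_nhdsGT ht.1] with s hs
    exact hanti ⟨hs.1, hs.2.trans ht.2⟩ ht hs.2.le
  have h1 : (v t - modelSol lam n t) ^ 2 ≤ 0 := by
    have : 0 ≤ (deriv v t - modelDeriv lam n t) ^ 2 := sq_nonneg _
    have h : (deriv v t - modelDeriv lam n t) ^ 2 + lam * (v t - modelSol lam n t) ^ 2 ≤ 0 := hle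
    nlinarith
  have := pow_eq_zero_iff (two_ne_zero) |>.1 (le_antisymm h1 (sq_nonneg _))
  linarith

lemma continuousAt_modelSeries (lam : ℝ) {N t : ℝ} (hN : 1 < N) :
    ContinuousAt (fun q : ℝ × ℝ => modelSeries lam q.1 q.2) (N, t) := by
  refine (continuousOn_modelSeries lam (|t| + 1)).continuousAt ?_
  rw [nhds_prod_eq]
  refine prod_mem_prod (Ici_mem_nhds hN) (Icc_mem_nhds ?_ ?_)
  · linarith [neg_abs_le t]
  · linarith [le_abs_self t]

/-- The dimension of the model can be increased without losing the bound on its maximum. -/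
lemma exists_modelSol_gt {n : ℕ} (hn : 1 ≤ n) {lam : ℝ} (hlam : 0 < lam) {b : ℝ} (hb : 0 < b)
    {v : ℝ → ℝ} (hvcont : ContinuousOn v (Icc 0 b)) (hvC2 : ContDiffOn ℝ 2 v (Ioo 0 b))
    (hode : ∀ t ∈ Ioo 0 b,
      deriv (deriv v) t + (((n : ℝ) - 1) / t) * deriv v t + lam * v t = 0)
    (hv0 : v 0 = -1) (hv'0 : Tendsto (deriv v) (𝓝[>] 0) (𝓝 0))
    (hv' : ∀ t ∈ Ioo 0 b, 0 < deriv v t) {m : ℝ} (hm : m < v b) :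
    ∃ N S : ℝ, n < N ∧ 0 < S ∧ (∀ s ∈ Ioc 0 S, 0 < modelDeriv lam N s) ∧ m < modelSol lam N S := by
  have hn1 : (1 : ℝ) ≤ n := by exact_mod_cast hn
  have heq := eq_modelSol hn hlam hb hvcont hvC2 hode hv0 hv'0
  obtain ⟨S, ⟨hS0, hSb⟩, hSm⟩ : ∃ S ∈ Ioo 0 b, m < v S := by
    have h1 : Tendsto v (𝓝[<] b) (𝓝 (v b)) := by
      rw [← nhdsWithin_Ioo_eq_nhdsLT hb]
      exact (hvcont b ⟨hb.le, le_rfl⟩).mono Ioo_subset_Icc_self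
    obtain ⟨S, h, h'⟩ := ((h1.eventually (lt_mem_nhds hm)).and (Ioo_mem_nhdsLT hb)).exists
    exact ⟨S, h', h⟩
  have hpos : ∀ s ∈ Icc 0 S, modelSeries lam (n + 2) (s ^ 2) < 0 := by
    rintro s ⟨hs0, hs⟩
    rcases hs0.eq_or_lt with rfl | hs0
    · norm_num [modelSeries_zero]
    · have hsb : s ∈ Ioo 0 b := ⟨hs0, hs.trans_lt hSb⟩
      have h1 : deriv v s = modelDeriv lam n s := by
        rw [(heq.eventuallyEq_of_mem (isOpen_Ioo.mem_nhds hsb)).deriv_eq]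
        exact (hasDerivAt_modelSol hn1 s).deriv
      have h2 := hv' s hsb
      rw [h1, modelDeriv, modelSol] at h2
      by_contra hcon
      push Not at hcon
      have : 0 ≤ lam / n * s * modelSeries lam (n + 2) (s ^ 2) := by positivity
      have e : -lam / n * s * modelSeries lam (n + 2) (s ^ 2) =
        -(lam / n * s * modelSeries lam (n + 2) (s ^ 2)) := by ring
      linarith
  have hev1 : ∀ᶠ N in 𝓝 (n : ℝ), ∀ s ∈ Icc 0 S, modelSeries lam (N + 2) (s ^ 2) < 0 := by
    refine isCompact_Icc.eventually_forall_of_forall_eventually fun s hs => ?_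
    have hc : ContinuousAt (fun q : ℝ × ℝ => modelSeries lam (q.1 + 2) (q.2 ^ 2)) ((n : ℝ), s) :=
      ContinuousAt.comp (g := fun q : ℝ × ℝ => modelSeries lam q.1 q.2)
        (f := fun q : ℝ × ℝ => (q.1 + 2, q.2 ^ 2))
        (continuousAt_modelSeries lam (by linarith)) (by fun_prop)
    exact hc.eventually (gt_mem_nhds (hpos s hs))
  have hev2 : ∀ᶠ N in 𝓝[>] (n : ℝ), m < modelSeries lam N (S ^ 2) := by
    have hc : ContinuousWithinAt (fun N => modelSeries lam N (S ^ 2)) (Ici 1) (n : ℝ) := by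
      refine ContinuousWithinAt.comp (g := fun q : ℝ × ℝ => modelSeries lam q.1 q.2)
        (f := fun N => (N, S ^ 2)) (t := Ici 1 ×ˢ Icc (-S ^ 2) (S ^ 2))
        (continuousOn_modelSeries lam (S ^ 2) ((n : ℝ), S ^ 2) ⟨hn1, ?_, le_rfl⟩ |>.mono ?_)
        (by fun_prop) ?_
      · nlinarith
      · simp
      · exact fun N hN => ⟨hN, by simp; positivity⟩
    have hlt : m < modelSeries lam n (S ^ 2) := by
      rw [heq ⟨hS0, hSb⟩] at hSm
      exact hSm
    exact (hc.mono fun N hN => hn1.trans (le_of_lt hN)).eventually (lt_mem_nhds hlt)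
  obtain ⟨N, ⟨h1, h2⟩, h3⟩ :=
    ((hev1.filter_mono nhdsWithin_le_nhds).and hev2 |>.and self_mem_nhdsWithin).exists
  refine ⟨N, S, h3, hS0, fun s hs => ?_, h2⟩
  have hN : 0 < N := by linarith [show (n : ℝ) < N from h3]
  have h4 := h1 s ⟨hs.1.le, hs.2⟩
  rw [modelDeriv, modelSol]
  have : 0 < lam / N * s * -modelSeries lam (N + 2) (s ^ 2) :=
    mul_pos (mul_pos (div_pos hlam hN) hs.1) (by linarith)
  have e : -lam / N * s * modelSeries lam (N + 2) (s ^ 2) =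
        (lam / N * s * -modelSeries lam (N + 2) (s ^ 2)) := by ring
  linarith

lemma exists_modelSol_lt {lam N : ℝ} (hN : 1 ≤ N) {κ : ℝ} (hκ : lam / N < κ) :
    ∃ r₀ > 0, ∀ r ∈ Ioo 0 r₀, modelSol lam N r < -1 + κ / 2 * r ^ 2 := by
  have hc : ContinuousAt (fun s => -lam / N * modelSol lam (N + 2) s - κ) 0 :=
    ((continuous_const.mul (continuous_modelSol (by linarith))).sub continuous_const).continuousAt
  have h0 : -lam / N * modelSol lam (N + 2) 0 - κ < 0 := by
    rw [modelSol_zero]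
    have : -lam / N * -1 = lam / N := by ring
    linarith
  obtain ⟨r₀, hr₀, hr⟩ := Metric.eventually_nhds_iff.1 (hc.eventually (gt_mem_nhds h0))
  refine ⟨r₀, hr₀, fun r hr' => ?_⟩
  have hd : ∀ s, HasDerivAt (fun s => modelSol lam N s - κ / 2 * s ^ 2)
      ((-lam / N * modelSol lam (N + 2) s - κ) * s) s := fun s => by
    refine ((hasDerivAt_modelSol hN s).sub ((hasDerivAt_pow 2 s).const_mul (κ / 2))).congr_deriv ?_
    rw [modelDeriv]
    push_cast
    ring
  have hanti : StrictAntiOn (fun s => modelSol lam N s - κ / 2 * s ^ 2) (Icc 0 r) := by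
    refine strictAntiOn_of_deriv_neg (convex_Icc 0 r)
      (fun s _ => (hd s).continuousAt.continuousWithinAt) fun s hs => ?_
    rw [interior_Icc] at hs
    rw [(hd s).deriv]
    refine mul_neg_of_neg_of_pos (hr ?_) hs.1
    rw [Real.dist_eq, sub_zero, abs_of_pos hs.1]
    exact hs.2.trans hr'.2
  have := hanti ⟨le_rfl, hr'.1.le⟩ ⟨hr'.1.le, le_rfl⟩ hr'.1
  simp only [modelSol_zero] at this
  linarith

/-- `f` is differentiable on the right of `0` near `0`, with first and second right
derivatives `f₁` and `f₂` at `0`. -/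
def HasJet (f : ℝ → ℝ) (f₁ f₂ : ℝ) : Prop :=
  ∃ f' : ℝ → ℝ, f' 0 = f₁ ∧ (∀ᶠ t in 𝓝[≥] 0, HasDerivWithinAt f (f' t) (Ici 0) t) ∧
    HasDerivWithinAt f' f₂ (Ici 0) 0

lemma HasJet.sub {f g : ℝ → ℝ} {f₁ f₂ g₁ g₂ : ℝ} (hf : HasJet f f₁ f₂) (hg : HasJet g g₁ g₂) :
    HasJet (fun t => f t - g t) (f₁ - g₁) (f₂ - g₂) := by
  obtain ⟨f', hf0, hf1, hf2⟩ := hf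
  obtain ⟨g', hg0, hg1, hg2⟩ := hg
  refine ⟨fun t => f' t - g' t, by simp only [hf0, hg0], ?_, hf2.sub hg2⟩
  filter_upwards [hf1, hg1] with t h1 h2 using h1.sub h2

lemma HasJet.hasDerivWithinAt {f : ℝ → ℝ} {f₁ f₂ : ℝ} (hf : HasJet f f₁ f₂) :
    HasDerivWithinAt f f₁ (Ici 0) 0 := by
  obtain ⟨f', rfl, hf1, -⟩ := hf
  exact hf1.self_of_nhdsWithin (mem_Ici.2 le_rfl)

lemma HasJet.comp {f : ℝ → ℝ} {f₁ f₂ : ℝ} (hf : HasJet f f₁ f₂) {φ φ' : ℝ → ℝ} {φ₂ : ℝ}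
    (hφ : ∀ᶠ x in 𝓝 (f 0), HasDerivAt φ (φ' x) x) (hφ' : HasDerivAt φ' φ₂ (f 0)) :
    HasJet (fun t => φ (f t)) (φ' (f 0) * f₁) (φ₂ * f₁ ^ 2 + φ' (f 0) * f₂) := by
  have hd := hf.hasDerivWithinAt
  obtain ⟨f', rfl, hf1, hf2⟩ := hf
  refine ⟨fun t => φ' (f t) * f' t, rfl, ?_, ?_⟩
  · filter_upwards [hf1, hd.continuousWithinAt.eventually hφ] with t h1 h2
    exact h2.comp_hasDerivWithinAt t h1
  · refine ((hφ'.comp_hasDerivWithinAt 0 hd).mul hf2).congr_deriv ?_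
    simp only [Function.comp]
    ring

lemma HasDerivWithinAt.nonpos_of_eventually_le {f : ℝ → ℝ} {f₁ : ℝ}
    (hf : HasDerivWithinAt f f₁ (Ici 0) 0) (hle : ∀ᶠ t in 𝓝[>] 0, f t ≤ f 0) : f₁ ≤ 0 := by
  have h := (hasDerivWithinAt_iff_tendsto_slope.1 hf)
  rw [Ici_sdiff_left] at h
  refine le_of_tendsto h ?_
  filter_upwards [hle, self_mem_nhdsWithin] with t h1 h2
  rw [slope_def_field, sub_zero]
  exact div_nonpos_of_nonpos_of_nonneg (by linarith) (le_of_lt h2)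

lemma HasJet.second_nonpos {f : ℝ → ℝ} {f₂ : ℝ} (hf : HasJet f 0 f₂)
    (hle : ∀ᶠ t in 𝓝[>] 0, f t ≤ f 0) : f₂ ≤ 0 := by
  by_contra! hpos
  obtain ⟨f', hf0, hf1, hf2⟩ := hf
  have h := (hasDerivWithinAt_iff_tendsto_slope.1 hf2)
  rw [Ici_sdiff_left] at h
  have h1 : ∀ᶠ t in 𝓝[>] (0 : ℝ), 0 < f' t := by
    filter_upwards [h.eventually (lt_mem_nhds hpos), self_mem_nhdsWithin] with t h1 h2
    rw [slope_def_field, sub_zero, hf0, sub_zero] at h1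
    exact (div_pos_iff_of_pos_right h2).1 h1
  have h2 := (h1.and (hle.and (hf1.filter_mono (nhdsWithin_mono _ Ioi_subset_Ici_self))))
  obtain ⟨ε, hε, hsub⟩ := mem_nhdsGT_iff_exists_Ioo_subset.1 h2
  have hε : 0 < ε := hε
  have hf0' : HasDerivWithinAt f (f' 0) (Ici 0) 0 :=
    hf1.self_of_nhdsWithin (mem_Ici.2 le_rfl)
  have hmono : StrictMonoOn f (Icc 0 (ε / 2)) := by
    refine strictMonoOn_of_deriv_pos (convex_Icc _ _) ?_ ?_
    · intro t ht
      rcases ht.1.eq_or_lt with rfl | h0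
      · exact hf0'.continuousWithinAt.mono Icc_subset_Ici_self
      · exact (hsub ⟨h0, by linarith [ht.2]⟩).2.2.continuousWithinAt.mono Icc_subset_Ici_self
    · intro t ht
      rw [interior_Icc] at ht
      have := hsub ⟨ht.1, by linarith [ht.2]⟩
      rw [(this.2.2.hasDerivAt (Ici_mem_nhds ht.1)).deriv]
      exact this.1
  have h3 := hmono ⟨le_rfl, by positivity⟩ (b := ε / 2) ⟨by positivity, le_rfl⟩ (by positivity)
  have h4 := (hsub (show ε / 2 ∈ Ioo 0 ε from ⟨by positivity, by linarith⟩)).2.1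
  linarith

/-- The gradient of `F² / 2`. -/
def flux {n : ℕ} (F : EuclideanSpace ℝ (Fin n) → ℝ) :
    EuclideanSpace ℝ (Fin n) → EuclideanSpace ℝ (Fin n) :=
  gradient fun η => F η ^ 2 / 2

namespace IsMinkowskiNorm

variable {n : ℕ} {F : EuclideanSpace ℝ (Fin n) → ℝ}

lemma map_zero (hF : IsMinkowskiNorm F) : F 0 = 0 := by
  simpa using hF.homog 0 0

lemma continuous (hF : IsMinkowskiNorm F) : Continuous F := by
  have := hF.convexOn.continuousOn isOpen_univ
  rwa [continuousOn_univ] at this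

lemma exists_bounds (hF : IsMinkowskiNorm F) :
    ∃ c > 0, ∃ C > 0, ∀ ξ, c * ‖ξ‖ ≤ F ξ ∧ F ξ ≤ C * ‖ξ‖ := by
  rcases (Metric.sphere (0 : EuclideanSpace ℝ (Fin n)) 1).eq_empty_or_nonempty with hs | hs
  · refine ⟨1, one_pos, 1, one_pos, fun ξ => ?_⟩
    have : ξ = 0 := by
      by_contra h
      have : ‖ξ‖⁻¹ • ξ ∈ Metric.sphere (0 : EuclideanSpace ℝ (Fin n)) 1 := by
        simp [norm_smul, h]
      simp [hs] at this
    simp [this, hF.map_zero]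
  · have hc := isCompact_sphere (0 : EuclideanSpace ℝ (Fin n)) 1
    obtain ⟨a, ha, hamin⟩ := hc.exists_isMinOn hs hF.continuous.continuousOn
    obtain ⟨b, hb, hbmax⟩ := hc.exists_isMaxOn hs hF.continuous.continuousOn
    have hne : ∀ a ∈ Metric.sphere (0 : EuclideanSpace ℝ (Fin n)) 1, a ≠ 0 := by
      rintro a ha rfl
      simp at ha
    refine ⟨F a, hF.pos a (hne a ha), F b, hF.pos b (hne b hb), fun ξ => ?_⟩
    by_cases h : ξ = 0
    · simp [h, hF.map_zero]
    have hmem : ‖ξ‖⁻¹ • ξ ∈ Metric.sphere (0 : EuclideanSpace ℝ (Fin n)) 1 := by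
      simp [norm_smul, h]
    have hval : F ξ = F (‖ξ‖⁻¹ • ξ) * ‖ξ‖ := by
      rw [hF.homog, abs_inv, abs_norm]
      have : ‖ξ‖ ≠ 0 := norm_ne_zero_iff.2 h
      field_simp
    rw [hval]
    exact ⟨mul_le_mul_of_nonneg_right (hamin hmem) (norm_nonneg _),
      mul_le_mul_of_nonneg_right (hbmax hmem) (norm_nonneg _)⟩

lemma add_le (hF : IsMinkowskiNorm F) (ξ η : EuclideanSpace ℝ (Fin n)) : F (ξ + η) ≤ F ξ + F η := by
  have h := hF.convexOn.2 (mem_univ ξ) (mem_univ η) (by norm_num : (0 : ℝ) ≤ 1 / 2)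
    (by norm_num : (0 : ℝ) ≤ 1 / 2) (by norm_num)
  rw [← smul_add, hF.homog] at h
  norm_num at h
  linarith

end IsMinkowskiNorm

namespace IsStronglyConvexMinkowskiNormC3

variable {n : ℕ} {F : EuclideanSpace ℝ (Fin n) → ℝ}

lemma contDiffAt_energy (hF : IsStronglyConvexMinkowskiNormC3 F) {ξ : EuclideanSpace ℝ (Fin n)}
    (hξ : ξ ≠ 0) : ContDiffAt ℝ 3 (fun η => F η ^ 2 / 2) ξ :=
  ((hF.contDiff3.contDiffAt (isOpen_compl_singleton.mem_nhds hξ)).pow 2).div_const 2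

lemma hasFDerivAt_energy_zero (hF : IsStronglyConvexMinkowskiNormC3 F) :
    HasFDerivAt (fun η => F η ^ 2 / 2) (0 : EuclideanSpace ℝ (Fin n) →L[ℝ] ℝ) 0 := by
  obtain ⟨c, hc, C, hC, h⟩ := hF.exists_bounds
  rw [hasFDerivAt_iff_isLittleO_nhds_zero]
  have h1 : (fun η : EuclideanSpace ℝ (Fin n) => ‖η‖ ^ 2) =o[𝓝 0] fun η => η := by
    simpa using (Asymptotics.isLittleO_norm_pow_id (E' := EuclideanSpace ℝ (Fin n)) one_lt_two)
  refine Asymptotics.IsBigO.trans_isLittleO ?_ h1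
  refine Asymptotics.IsBigO.of_bound (C ^ 2 / 2) (Eventually.of_forall fun η => ?_)
  have h0 := hF.nonneg η
  have h2 := pow_le_pow_left₀ h0 (h η).2 2
  simp only [zero_add, hF.map_zero, _root_.zero_apply]
  norm_num
  nlinarith

lemma hasGradientAt_energy (hF : IsStronglyConvexMinkowskiNormC3 F)
    (ξ : EuclideanSpace ℝ (Fin n)) : HasGradientAt (fun η => F η ^ 2 / 2) (flux F ξ) ξ := by
  refine DifferentiableAt.hasGradientAt ?_
  by_cases hξ : ξ = 0
  · rw [hξ]
    exact hF.hasFDerivAt_energy_zero.differentiableAt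
  · exact (hF.contDiffAt_energy hξ).differentiableAt (by norm_num)

lemma flux_zero (hF : IsStronglyConvexMinkowskiNormC3 F) : flux F 0 = 0 := by
  rw [flux, gradient, hF.hasFDerivAt_energy_zero.fderiv, _root_.map_zero]

lemma hasDerivAt_energy_line (hF : IsStronglyConvexMinkowskiNormC3 F)
    (ξ η : EuclideanSpace ℝ (Fin n)) (t : ℝ) :
    HasDerivAt (fun t : ℝ => F (ξ + t • η) ^ 2 / 2) ⟪flux F (ξ + t • η), η⟫ t := by
  have h1 : HasDerivAt (fun t : ℝ => ξ + t • η) η t := by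
    simpa using ((hasDerivAt_id t).smul_const η).const_add ξ
  have := (hF.hasGradientAt_energy (ξ + t • η)).hasFDerivAt.comp_hasDerivAt t h1
  rwa [InnerProductSpace.toDual_apply_apply] at this

lemma inner_flux_self (hF : IsStronglyConvexMinkowskiNormC3 F) (ξ : EuclideanSpace ℝ (Fin n)) :
    ⟪flux F ξ, ξ⟫ = F ξ ^ 2 := by
  have h1 := hF.hasDerivAt_energy_line ξ ξ 0
  have h2 : HasDerivAt (fun t : ℝ => (1 + t) ^ 2 * F ξ ^ 2 / 2) (F ξ ^ 2) 0 := by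
    have := ((((hasDerivAt_id (0 : ℝ)).const_add 1).pow 2).mul_const (F ξ ^ 2)).div_const 2
    refine this.congr_deriv ?_
    simp
  have h3 : (fun t : ℝ => F (ξ + t • ξ) ^ 2 / 2) = fun t : ℝ => (1 + t) ^ 2 * F ξ ^ 2 / 2 := by
    ext t
    rw [show ξ + t • ξ = (1 + t) • ξ by module, hF.homog, mul_pow, sq_abs]
  rw [h3, zero_smul, add_zero] at h1
  exact h1.unique h2

lemma inner_flux_le (hF : IsStronglyConvexMinkowskiNormC3 F) (ξ η : EuclideanSpace ℝ (Fin n)) :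
    ⟪flux F ξ, η⟫ ≤ F ξ * F η := by
  have h1 := hF.hasDerivAt_energy_line ξ η 0
  have h2 : HasDerivAt (fun t : ℝ => (F ξ + t * F η) ^ 2 / 2) (F ξ * F η) 0 := by
    have := ((((hasDerivAt_id (0 : ℝ)).mul_const (F η)).const_add (F ξ)).pow 2).div_const 2
    refine this.congr_deriv ?_
    simp only [id]
    push_cast
    ring
  have h3 := (h1.sub h2).hasDerivWithinAt (s := Ici 0)
  have h4 := h3.nonpos_of_eventually_le (by
    filter_upwards [self_mem_nhdsWithin] with t ht
    have ht : 0 < t := ht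
    have h5 := hF.add_le ξ (t • η)
    rw [hF.homog, abs_of_pos ht] at h5
    have h6 := pow_le_pow_left₀ (hF.nonneg _) h5 2
    simp only [Pi.sub_apply, zero_smul, add_zero, zero_mul]
    linarith)
  simp only [zero_smul, add_zero] at h4
  linarith

lemma flux_smul (hF : IsStronglyConvexMinkowskiNormC3 F) (t : ℝ) (ξ : EuclideanSpace ℝ (Fin n)) :
    flux F (t • ξ) = t • flux F ξ := by
  by_cases ht : t = 0
  · simp [ht, hF.flux_zero]
  refine ext_inner_right ℝ fun w => ?_
  have h1 := hF.hasDerivAt_energy_line (t • ξ) (t • w) 0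
  have h2 := (hF.hasDerivAt_energy_line ξ w 0).const_mul (t ^ 2)
  have h3 : (fun s : ℝ => F (t • ξ + s • t • w) ^ 2 / 2) =
      fun s : ℝ => t ^ 2 * (F (ξ + s • w) ^ 2 / 2) := by
    ext s
    rw [show t • ξ + s • t • w = t • (ξ + s • w) by module, hF.homog, mul_pow, sq_abs]
    ring
  rw [h3] at h1
  have h4 := h1.unique h2
  simp only [zero_smul, add_zero, inner_smul_right] at h4
  rw [inner_smul_left]
  simp only [conj_trivial]
  apply mul_left_cancel₀ ht
  linarith

lemma flux_eq_smul_gradient (hF : IsStronglyConvexMinkowskiNormC3 F)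
    (ξ : EuclideanSpace ℝ (Fin n)) : F ξ • gradient F ξ = flux F ξ := by
  by_cases hξ : ξ = 0
  · rw [hξ, hF.map_zero, zero_smul, hF.flux_zero]
  have h1 : DifferentiableAt ℝ F ξ :=
    (hF.contDiff3.contDiffAt (isOpen_compl_singleton.mem_nhds hξ)).differentiableAt (by norm_num)
  refine ext_inner_right ℝ fun w => ?_
  have hl : HasDerivAt (fun t : ℝ => ξ + t • w) w 0 := by
    simpa using ((hasDerivAt_id (0 : ℝ)).smul_const w).const_add ξ
  have h2 : HasFDerivAt F (InnerProductSpace.toDual ℝ _ (gradient F ξ)) (ξ + (0 : ℝ) • w) := by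
    simpa using h1.hasGradientAt.hasFDerivAt
  have h3 := ((h2.comp_hasDerivAt 0 hl).pow 2).div_const 2
  have h4 := h3.unique (hF.hasDerivAt_energy_line ξ w 0)
  simp only [InnerProductSpace.toDual_apply_apply, Function.comp, zero_smul, add_zero] at h4
  rw [inner_smul_left, ← h4]
  simp only [conj_trivial]
  push_cast
  ring

lemma contDiffAt_flux (hF : IsStronglyConvexMinkowskiNormC3 F) {ξ : EuclideanSpace ℝ (Fin n)}
    (hξ : ξ ≠ 0) : ContDiffAt ℝ 2 (flux F) ξ :=
  (InnerProductSpace.toDual ℝ _).symm.contDiff.contDiffAt.comp ξ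
    ((hF.contDiffAt_energy hξ).fderiv_right (by norm_num))

lemma continuous_flux (hF : IsStronglyConvexMinkowskiNormC3 F) : Continuous (flux F) := by
  obtain ⟨c, hc, C, hC, h⟩ := hF.exists_bounds
  refine continuous_iff_continuousAt.2 fun ξ => ?_
  by_cases hξ : ξ = 0
  · have hb : ∀ ξ, ‖flux F ξ‖ ≤ C ^ 2 * ‖ξ‖ := by
      intro ξ
      by_cases h0 : flux F ξ = 0
      · rw [h0, norm_zero]
        positivity
      have h1 := hF.inner_flux_le ξ (flux F ξ)
      rw [real_inner_self_eq_norm_sq] at h1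
      have h2 := mul_le_mul (h ξ).2 (h (flux F ξ)).2 (hF.nonneg _) (by positivity)
      have h3 : 0 < ‖flux F ξ‖ := norm_pos_iff.2 h0
      nlinarith
    rw [hξ, ContinuousAt, hF.flux_zero]
    refine squeeze_zero_norm hb ?_
    have : Continuous fun ξ : EuclideanSpace ℝ (Fin n) => C ^ 2 * ‖ξ‖ := by fun_prop
    simpa using this.tendsto 0
  · exact (hF.contDiffAt_flux hξ).continuousAt

lemma flux_eq_zero (hF : IsStronglyConvexMinkowskiNormC3 F) {ξ : EuclideanSpace ℝ (Fin n)}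
    (h : flux F ξ = 0) : ξ = 0 := by
  by_contra hξ
  have h1 := hF.inner_flux_self ξ
  rw [h, inner_zero_left] at h1
  exact (pow_pos (hF.pos ξ hξ) 2).ne h1

lemma exists_flux_eq (hF : IsStronglyConvexMinkowskiNormC3 F) (z : EuclideanSpace ℝ (Fin n)) :
    ∃ ξ, flux F ξ = z := by
  obtain ⟨c, hc, C, hC, h⟩ := hF.exists_bounds
  have hcont : Continuous fun ξ => F ξ ^ 2 / 2 - ⟪z, ξ⟫ := by
    have := hF.continuous
    fun_prop
  have hlim : Tendsto (fun ξ => F ξ ^ 2 / 2 - ⟪z, ξ⟫) (cocompact _) atTop := by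
    have h1 : Tendsto (fun x : ℝ => x * (c ^ 2 / 2 * x - ‖z‖)) atTop atTop :=
      tendsto_id.atTop_mul_atTop₀
        (tendsto_atTop_add_const_right _ _ (tendsto_id.const_mul_atTop (by positivity)))
    refine tendsto_atTop_mono (fun ξ => ?_) (h1.comp (tendsto_norm_cocompact_atTop))
    have h2 := pow_le_pow_left₀ (by positivity) (h ξ).1 2
    have h3 := real_inner_le_norm z ξ
    simp only [Function.comp]
    nlinarith
  obtain ⟨ξ, hξ⟩ := hcont.exists_forall_le hlim
  refine ⟨ξ, ?_⟩
  have h1 : HasFDerivAt (fun ξ => F ξ ^ 2 / 2 - ⟪z, ξ⟫)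
      (InnerProductSpace.toDual ℝ _ (flux F ξ) - innerSL ℝ z) ξ :=
    (hF.hasGradientAt_energy ξ).hasFDerivAt.sub (innerSL ℝ z).hasFDerivAt
  have h2 := IsLocalMin.hasFDerivAt_eq_zero (Eventually.of_forall hξ) h1
  refine ext_inner_right ℝ fun w => ?_
  have h3 := DFunLike.congr_fun h2 w
  simp at h3
  linarith

end IsStronglyConvexMinkowskiNormC3

namespace IsStronglyConvexMinkowskiNormC3

variable {n : ℕ} {F : EuclideanSpace ℝ (Fin n) → ℝ} {ξ : EuclideanSpace ℝ (Fin n)}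

lemma hasFDerivAt_flux (hF : IsStronglyConvexMinkowskiNormC3 F) (hξ : ξ ≠ 0) :
    HasFDerivAt (flux F) (fderiv ℝ (flux F) ξ) ξ :=
  ((hF.contDiffAt_flux hξ).differentiableAt (by norm_num)).hasFDerivAt

lemma aCoeff_eq (hF : IsStronglyConvexMinkowskiNormC3 F) (hξ : ξ ≠ 0) (i j : Fin n) :
    aCoeff F i j ξ =
      ⟪fderiv ℝ (flux F) ξ (EuclideanSpace.single j 1), EuclideanSpace.single i 1⟫ := by
  have h1 : pd (fun η => F η ^ 2 / 2) i =
      fun η => ⟪flux F η, EuclideanSpace.single i (1 : ℝ)⟫ := by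
    ext η
    rw [pd, (hF.hasGradientAt_energy η).hasFDerivAt.fderiv, InnerProductSpace.toDual_apply_apply]
  have h2 := (hF.hasFDerivAt_flux hξ).inner ℝ
    (hasFDerivAt_const (EuclideanSpace.single i (1 : ℝ)) ξ)
  rw [aCoeff, h1, pd, h2.fderiv]
  simp

lemma inner_fderiv_flux_comm (hF : IsStronglyConvexMinkowskiNormC3 F) (hξ : ξ ≠ 0)
    (V W : EuclideanSpace ℝ (Fin n)) :
    ⟪fderiv ℝ (flux F) ξ V, W⟫ = ⟪fderiv ℝ (flux F) ξ W, V⟫ := by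
  have h0 := (hF.contDiffAt_energy hξ)
  have h1 := h0.isSymmSndFDerivAt (by simp; norm_num)
  have h2 : HasFDerivAt (fderiv ℝ fun η => F η ^ 2 / 2)
      (fderiv ℝ (fderiv ℝ fun η => F η ^ 2 / 2) ξ) ξ :=
    ((h0.fderiv_right (m := 2) (by norm_num)).differentiableAt (by norm_num)).hasFDerivAt
  have h3 : ∀ V W, ⟪fderiv ℝ (flux F) ξ V, W⟫ =
      fderiv ℝ (fderiv ℝ fun η => F η ^ 2 / 2) ξ V W := by
    intro V W
    have h4 := (InnerProductSpace.toDual ℝ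
      (EuclideanSpace ℝ (Fin n))).symm.toContinuousLinearEquiv.hasFDerivAt.comp ξ h2
    have h5 := (hF.hasFDerivAt_flux hξ).unique h4
    rw [h5]
    exact InnerProductSpace.toDual_symm_apply
  rw [h3, h3, h1]

lemma sum_aCoeff_mul (hF : IsStronglyConvexMinkowskiNormC3 F) (hξ : ξ ≠ 0)
    (V W : EuclideanSpace ℝ (Fin n)) :
    ∑ i, ∑ j, aCoeff F i j ξ * V i * W j = ⟪fderiv ℝ (flux F) ξ W, V⟫ := by
  have hV : ∀ V : EuclideanSpace ℝ (Fin n), V = ∑ i, V i • EuclideanSpace.single i (1 : ℝ) := by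
    intro V
    simpa using ((EuclideanSpace.basisFun (Fin n) ℝ).sum_repr V).symm
  conv_rhs => rw [hV V, hV W]
  simp only [map_sum, map_smul, inner_sum, sum_inner, inner_smul_left, inner_smul_right,
    hF.aCoeff_eq hξ, conj_trivial, Finset.mul_sum]
  refine Finset.sum_congr rfl fun i _ => Finset.sum_congr rfl fun j _ => by ring

lemma inner_fderiv_flux_pos (hF : IsStronglyConvexMinkowskiNormC3 F) (hξ : ξ ≠ 0)
    {V : EuclideanSpace ℝ (Fin n)} (hV : V ≠ 0) : 0 < ⟪fderiv ℝ (flux F) ξ V, V⟫ := by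
  rw [← hF.sum_aCoeff_mul hξ]
  exact hF.posDef ξ hξ V hV

lemma fderiv_flux_injective (hF : IsStronglyConvexMinkowskiNormC3 F) (hξ : ξ ≠ 0) :
    Function.Injective (fderiv ℝ (flux F) ξ) := by
  rw [injective_iff_map_eq_zero]
  intro V hV
  by_contra h
  have := hF.inner_fderiv_flux_pos hξ h
  rw [hV, inner_zero_left] at this
  exact lt_irrefl _ this

lemma fderiv_flux_smul (hF : IsStronglyConvexMinkowskiNormC3 F) (hξ : ξ ≠ 0) {t : ℝ}
    (ht : t ≠ 0) : fderiv ℝ (flux F) (t • ξ) = fderiv ℝ (flux F) ξ := by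
  have h1 : HasFDerivAt (fun η => flux F (t • η))
      ((fderiv ℝ (flux F) (t • ξ)).comp (t • ContinuousLinearMap.id ℝ _)) ξ :=
    (hF.hasFDerivAt_flux (smul_ne_zero ht hξ)).comp ξ ((hasFDerivAt_id ξ).const_smul t)
  have h2 := (hF.hasFDerivAt_flux hξ).const_smul t
  have h3 : (fun η => flux F (t • η)) = t • flux F := by
    ext1 η
    exact hF.flux_smul t η
  rw [h3] at h1
  have h4 := h1.unique h2
  ext1 V
  have h5 := DFunLike.congr_fun h4 V
  simp only [ContinuousLinearMap.comp_smul, ContinuousLinearMap.comp_id] at h5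
  exact smul_right_injective _ ht h5

lemma aCoeff_smul (hF : IsStronglyConvexMinkowskiNormC3 F) (hξ : ξ ≠ 0) {t : ℝ}
    (ht : t ≠ 0) (i j : Fin n) : aCoeff F i j (t • ξ) = aCoeff F i j ξ := by
  rw [hF.aCoeff_eq hξ, hF.aCoeff_eq (smul_ne_zero ht hξ), hF.fderiv_flux_smul hξ ht]

lemma fderiv_flux_self (hF : IsStronglyConvexMinkowskiNormC3 F) (hξ : ξ ≠ 0) :
    fderiv ℝ (flux F) ξ ξ = flux F ξ := by
  have h1 : HasDerivAt (fun t : ℝ => t • ξ) ξ 1 := by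
    simpa using (hasDerivAt_id (1 : ℝ)).smul_const ξ
  have h2 : HasFDerivAt (flux F) (fderiv ℝ (flux F) ξ) ((1 : ℝ) • ξ) := by
    simpa using hF.hasFDerivAt_flux hξ
  have h3 := h2.comp_hasDerivAt 1 h1
  have h4 : (flux F ∘ fun t : ℝ => t • ξ) = fun t : ℝ => t • flux F ξ := by
    ext1 t
    exact hF.flux_smul t ξ
  rw [h4] at h3
  have h5 : HasDerivAt (fun t : ℝ => t • flux F ξ) (flux F ξ) 1 := by
    simpa using (hasDerivAt_id (1 : ℝ)).smul_const (flux F ξ)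
  exact h3.unique h5

lemma continuousOn_aCoeff (hF : IsStronglyConvexMinkowskiNormC3 F) (i j : Fin n) :
    ContinuousOn (aCoeff F i j) {0}ᶜ := by
  have h : ContinuousOn (fun ξ => ⟪fderiv ℝ (flux F) ξ (EuclideanSpace.single j 1),
      EuclideanSpace.single i (1 : ℝ)⟫) {0}ᶜ := by
    intro ξ hξ
    have h1 : ContinuousAt (fderiv ℝ (flux F)) ξ :=
      ((hF.contDiffAt_flux hξ).fderiv_right (m := 1) (by norm_num)).continuousAt
    exact ((h1.clm_apply continuousAt_const).inner continuousAt_const).continuousWithinAt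
  exact h.congr fun ξ hξ => hF.aCoeff_eq hξ i j

/-- Strict monotonicity of the flux along a segment. -/
lemma eq_zero_of_inner_flux {p ν : EuclideanSpace ℝ (Fin n)}
    (hF : IsStronglyConvexMinkowskiNormC3 F) (hp : p ≠ 0) (h0 : 0 ≤ ⟪flux F p, ν⟫)
    (h1 : ⟪flux F (p + ν), ν⟫ ≤ 0) : ν = 0 := by
  by_contra hν
  by_cases hz : ∃ t ∈ Icc (0 : ℝ) 1, p + t • ν = 0
  · obtain ⟨t, ht, h⟩ := hz
    have ht0 : 0 < t := by
      rcases ht.1.eq_or_lt with rfl | h'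
      · simp [hp] at h
      · exact h'
    have hpν : p = -(t • ν) := eq_neg_of_add_eq_zero_left h
    rw [hpν, ← neg_smul, hF.flux_smul, inner_smul_left, hF.inner_flux_self] at h0
    have := pow_pos (hF.pos ν hν) 2
    simp only [conj_trivial] at h0
    nlinarith
  · push Not at hz
    have hd : ∀ t ∈ Icc (0 : ℝ) 1, HasDerivAt (fun t : ℝ => ⟪flux F (p + t • ν), ν⟫)
        ⟪fderiv ℝ (flux F) (p + t • ν) ν, ν⟫ t := by
      intro t ht
      have h1 : HasDerivAt (fun t : ℝ => p + t • ν) ν t := by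
        simpa using ((hasDerivAt_id t).smul_const ν).const_add p
      have := ((hF.hasFDerivAt_flux (hz t ht)).comp_hasDerivAt t h1).inner ℝ
        (hasDerivAt_const t ν)
      simpa using this
    have hm : StrictMonoOn (fun t : ℝ => ⟪flux F (p + t • ν), ν⟫) (Icc 0 1) := by
      refine strictMonoOn_of_deriv_pos (convex_Icc _ _)
        (fun t ht => (hd t ht).continuousAt.continuousWithinAt) fun t ht => ?_
      rw [interior_Icc] at ht
      have ht' := Ioo_subset_Icc_self ht
      rw [(hd t ht').deriv]
      exact hF.inner_fderiv_flux_pos (hz t ht') hν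
    have := hm (left_mem_Icc.2 zero_le_one) (right_mem_Icc.2 zero_le_one) one_pos
    simp only [zero_smul, add_zero, one_smul] at this
    linarith

/-- A basis adapted to the second fundamental tensor of `F` at `p`. -/
lemma exists_frame {p : EuclideanSpace ℝ (Fin n)}
    (hF : IsStronglyConvexMinkowskiNormC3 F) (hp : p ≠ 0) :
    ∃ W η : Fin n → EuclideanSpace ℝ (Fin n),
      (∀ k, fderiv ℝ (flux F) p (η k) = W k) ∧ (∀ k, ⟪η k, W k⟫ = 1) ∧
      ∀ T : EuclideanSpace ℝ (Fin n) →L[ℝ] EuclideanSpace ℝ (Fin n),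
        ∑ k, ⟪T (W k), W k⟫ = ∑ i, ∑ j, aCoeff F i j p *
          ⟪T (EuclideanSpace.single j 1), EuclideanSpace.single i 1⟫ := by
  set A := fderiv ℝ (flux F) p with hA
  have hsymm : (A : EuclideanSpace ℝ (Fin n) →ₗ[ℝ] EuclideanSpace ℝ (Fin n)).IsSymmetric := by
    intro V W
    change ⟪A V, W⟫ = ⟪V, A W⟫
    rw [real_inner_comm (A W) V]
    exact hF.inner_fderiv_flux_comm hp V W
  have hfin : Module.finrank ℝ (EuclideanSpace ℝ (Fin n)) = n := by simp
  set e := hsymm.eigenvectorBasis hfin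
  set μ := hsymm.eigenvalues hfin
  have he : ∀ k, A (e k) = μ k • e k := fun k => hsymm.apply_eigenvectorBasis hfin k
  have hee : ∀ k, ⟪e k, e k⟫ = 1 := fun k => by
    rw [real_inner_self_eq_norm_sq, e.orthonormal.1 k, one_pow]
  have hμ : ∀ k, 0 < μ k := by
    intro k
    have h1 : e k ≠ 0 := e.orthonormal.ne_zero k
    have h2 := hF.inner_fderiv_flux_pos hp h1
    rw [← hA, he, inner_smul_left, hee] at h2
    simpa using h2
  refine ⟨fun k => √(μ k) • e k, fun k => (√(μ k))⁻¹ • e k, fun k => ?_, fun k => ?_, fun T => ?_⟩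
  · rw [map_smul, he, smul_smul]
    congr 1
    rw [inv_mul_eq_div, div_sqrt]
  · have := (sqrt_pos.2 (hμ k)).ne'
    rw [inner_smul_left, inner_smul_right, hee]
    simp [this]
  · have h1 := LinearMap.trace_eq_sum_inner ((T.comp A : EuclideanSpace ℝ (Fin n) →L[ℝ] _) :
      EuclideanSpace ℝ (Fin n) →ₗ[ℝ] _) e
    have h2 := LinearMap.trace_eq_sum_inner ((A.comp T : EuclideanSpace ℝ (Fin n) →L[ℝ] _) :
      EuclideanSpace ℝ (Fin n) →ₗ[ℝ] _) (EuclideanSpace.basisFun (Fin n) ℝ)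
    have h3 := LinearMap.trace_mul_comm ℝ (T : EuclideanSpace ℝ (Fin n) →ₗ[ℝ] _) A
    have h4 : ∑ k, ⟪T (√(μ k) • e k), √(μ k) • e k⟫ = ∑ k, ⟪e k, T (A (e k))⟫ := by
      refine Finset.sum_congr rfl fun k _ => ?_
      rw [he, map_smul, map_smul, inner_smul_left, inner_smul_right, inner_smul_right,
        ← mul_assoc, conj_trivial, mul_self_sqrt (hμ k).le, real_inner_comm]
    rw [h4]
    refine (h1.symm.trans (h3.trans h2)).trans ?_
    rw [Finset.sum_comm]
    refine Finset.sum_congr rfl fun j _ => ?_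
    simp only [EuclideanSpace.basisFun_apply]
    have h5 := hF.sum_aCoeff_mul hp (T (EuclideanSpace.single j 1)) (EuclideanSpace.single j 1)
    change ⟪_, A (T _)⟫ = _
    rw [real_inner_comm, hF.inner_fderiv_flux_comm hp, ← h5]
    refine Finset.sum_congr rfl fun i _ => ?_
    rw [Finset.sum_eq_single j]
    · simp [EuclideanSpace.inner_single_right]
    · intro b _ hb
      simp [hb]
    · simp

lemma sum_inner_frame_sq {p : EuclideanSpace ℝ (Fin n)}
    (hF : IsStronglyConvexMinkowskiNormC3 F) (hp : p ≠ 0) {W : Fin n → EuclideanSpace ℝ (Fin n)}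
    (hW : ∀ T : EuclideanSpace ℝ (Fin n) →L[ℝ] EuclideanSpace ℝ (Fin n),
        ∑ k, ⟪T (W k), W k⟫ = ∑ i, ∑ j, aCoeff F i j p *
          ⟪T (EuclideanSpace.single j 1), EuclideanSpace.single i 1⟫) :
    ∑ k, ⟪p, W k⟫ ^ 2 = F p ^ 2 := by
  have h := hW ((innerSL ℝ p).smulRight p)
  simp only [ContinuousLinearMap.smulRight_apply, innerSL_apply_apply, inner_smul_left,
    conj_trivial] at h
  rw [← hF.inner_flux_self, ← hF.fderiv_flux_self hp, ← hF.sum_aCoeff_mul hp]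
  simp only [sq]
  rw [h]
  refine Finset.sum_congr rfl fun i _ => Finset.sum_congr rfl fun j _ => ?_
  simp [EuclideanSpace.inner_single_right]
  ring

end IsStronglyConvexMinkowskiNormC3

/-- A right inverse of the flux map of `F`. -/
def fluxInv {n : ℕ} (F : EuclideanSpace ℝ (Fin n) → ℝ) :
    EuclideanSpace ℝ (Fin n) → EuclideanSpace ℝ (Fin n) :=
  Function.invFun (flux F)

/-- The dual norm of `F`. -/
def dualNorm {n : ℕ} (F : EuclideanSpace ℝ (Fin n) → ℝ) (z : EuclideanSpace ℝ (Fin n)) : ℝ :=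
  F (fluxInv F z)

namespace IsStronglyConvexMinkowskiNormC3

variable {n : ℕ} {F : EuclideanSpace ℝ (Fin n) → ℝ}

lemma flux_fluxInv (hF : IsStronglyConvexMinkowskiNormC3 F) (z : EuclideanSpace ℝ (Fin n)) :
    flux F (fluxInv F z) = z :=
  Function.invFun_eq (hF.exists_flux_eq z)

lemma inner_le_dualNorm_mul (hF : IsStronglyConvexMinkowskiNormC3 F)
    (z η : EuclideanSpace ℝ (Fin n)) : ⟪z, η⟫ ≤ dualNorm F z * F η := by
  have := hF.inner_flux_le (fluxInv F z) η
  rwa [hF.flux_fluxInv] at this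

lemma inner_fluxInv (hF : IsStronglyConvexMinkowskiNormC3 F) (z : EuclideanSpace ℝ (Fin n)) :
    ⟪z, fluxInv F z⟫ = dualNorm F z ^ 2 := by
  have := hF.inner_flux_self (fluxInv F z)
  rwa [hF.flux_fluxInv] at this

lemma dualNorm_le_of_forall (hF : IsStronglyConvexMinkowskiNormC3 F)
    {z : EuclideanSpace ℝ (Fin n)} {a : ℝ} (ha : 0 ≤ a) (h : ∀ η, ⟪z, η⟫ ≤ a * F η) :
    dualNorm F z ≤ a := by
  have h1 := h (fluxInv F z)
  rw [hF.inner_fluxInv] at h1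
  change dualNorm F z ^ 2 ≤ a * dualNorm F z at h1
  have h2 : 0 ≤ dualNorm F z := hF.nonneg _
  by_contra! h3
  nlinarith

lemma dualNorm_flux (hF : IsStronglyConvexMinkowskiNormC3 F) (ξ : EuclideanSpace ℝ (Fin n)) :
    dualNorm F (flux F ξ) = F ξ := by
  refine le_antisymm (hF.dualNorm_le_of_forall (hF.nonneg _) (hF.inner_flux_le ξ)) ?_
  have h1 := hF.inner_le_dualNorm_mul (flux F ξ) ξ
  rw [hF.inner_flux_self] at h1
  by_contra! h3
  have h4 : 0 ≤ dualNorm F (flux F ξ) := hF.nonneg _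
  nlinarith

lemma dualNorm_smul (hF : IsStronglyConvexMinkowskiNormC3 F) (t : ℝ)
    (z : EuclideanSpace ℝ (Fin n)) : dualNorm F (t • z) = |t| * dualNorm F z := by
  obtain ⟨ξ, rfl⟩ := hF.exists_flux_eq z
  rw [← hF.flux_smul, hF.dualNorm_flux, hF.dualNorm_flux, hF.homog]

lemma isMinkowskiNorm_dualNorm (hF : IsStronglyConvexMinkowskiNormC3 F) :
    IsMinkowskiNorm (dualNorm F) where
  nonneg z := hF.nonneg _
  convexOn := by
    refine ⟨convex_univ, fun z _ w _ a b ha hb _ => ?_⟩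
    have hz : 0 ≤ dualNorm F z := hF.nonneg _
    have hw : 0 ≤ dualNorm F w := hF.nonneg _
    refine hF.dualNorm_le_of_forall (by positivity) fun η => ?_
    rw [inner_add_left, inner_smul_left, inner_smul_left]
    simp only [conj_trivial, smul_eq_mul]
    have h1 := mul_le_mul_of_nonneg_left (hF.inner_le_dualNorm_mul z η) ha
    have h2 := mul_le_mul_of_nonneg_left (hF.inner_le_dualNorm_mul w η) hb
    linarith
  even z := by
    have := hF.dualNorm_smul (-1) z
    simpa using this
  homog := hF.dualNorm_smul
  pos z hz := by
    refine hF.pos _ fun h => hz ?_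
    rw [← hF.flux_fluxInv z, h, hF.flux_zero]

lemma contDiffAt_dualNorm (hF : IsStronglyConvexMinkowskiNormC3 F)
    {z : EuclideanSpace ℝ (Fin n)} (hz : z ≠ 0) : ContDiffAt ℝ 2 (dualNorm F) z := by
  obtain ⟨ξ, rfl⟩ := hF.exists_flux_eq z
  have hξ : ξ ≠ 0 := by
    rintro rfl
    exact hz hF.flux_zero
  have hinj := hF.fderiv_flux_injective hξ
  set A := (LinearEquiv.ofInjectiveEndo (fderiv ℝ (flux F) ξ :
    EuclideanSpace ℝ (Fin n) →ₗ[ℝ] EuclideanSpace ℝ (Fin n)) hinj).toContinuousLinearEquiv with hA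
  have hA' : HasFDerivAt (flux F)
      (A : EuclideanSpace ℝ (Fin n) →L[ℝ] EuclideanSpace ℝ (Fin n)) ξ := by
    refine (hF.hasFDerivAt_flux hξ).congr_fderiv ?_
    ext1 V
    rfl
  have hc := hF.contDiffAt_flux hξ
  have h1 := hc.to_localInverse hA' (by norm_num)
  have h2 : ∀ᶠ z in 𝓝 (flux F ξ), flux F (hc.localInverse hA' (by norm_num) z) = z :=
    (hc.hasStrictFDerivAt' hA' (by norm_num)).eventually_right_inverse
  have h3 : ContDiffAt ℝ 2 (fun z => F (hc.localInverse hA' (by norm_num) z)) (flux F ξ) := by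
    refine ContDiffAt.comp (flux F ξ) (g := F) ?_ h1
    rw [hc.localInverse_apply_image]
    exact (hF.contDiff3.contDiffAt (isOpen_compl_singleton.mem_nhds hξ)).of_le (by norm_num)
  refine h3.congr_of_eventuallyEq ?_
  filter_upwards [h2] with z hz
  conv_lhs => rw [← hz]
  exact hF.dualNorm_flux _

lemma hasGradientAt_dualNorm (hF : IsStronglyConvexMinkowskiNormC3 F)
    {ξ : EuclideanSpace ℝ (Fin n)} (hξ : ξ ≠ 0) :
    HasGradientAt (dualNorm F) ((F ξ)⁻¹ • ξ) (flux F ξ) := by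
  have hz : flux F ξ ≠ 0 := fun h => hξ (hF.flux_eq_zero h)
  have hd := ((hF.contDiffAt_dualNorm hz).differentiableAt (by norm_num)).hasFDerivAt
  have hpos := hF.pos ξ hξ
  have h1 : HasFDerivAt (fun z => dualNorm F z - ⟪(F ξ)⁻¹ • ξ, z⟫)
      (fderiv ℝ (dualNorm F) (flux F ξ) - innerSL ℝ ((F ξ)⁻¹ • ξ)) (flux F ξ) :=
    hd.sub (innerSL ℝ ((F ξ)⁻¹ • ξ)).hasFDerivAt
  have h2 : IsLocalMin (fun z => dualNorm F z - ⟪(F ξ)⁻¹ • ξ, z⟫) (flux F ξ) := by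
    refine Eventually.of_forall fun z => ?_
    simp only [inner_smul_left, conj_trivial]
    rw [hF.dualNorm_flux, real_inner_comm, hF.inner_flux_self, real_inner_comm]
    have h3 := mul_le_mul_of_nonneg_left (hF.inner_le_dualNorm_mul z ξ) (inv_pos.2 hpos).le
    have h4 : (F ξ)⁻¹ * (dualNorm F z * F ξ) = dualNorm F z := by field_simp
    have h5 : (F ξ)⁻¹ * F ξ ^ 2 = F ξ := by field_simp
    linarith
  have h3 := h2.hasFDerivAt_eq_zero h1
  rw [hasGradientAt_iff_hasFDerivAt]
  refine hd.congr_fderiv ?_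
  rw [sub_eq_zero.1 h3]
  ext1 w
  simp

/-- First and second derivatives of the dual norm along a line. -/
lemma hasJet_dualNorm (hF : IsStronglyConvexMinkowskiNormC3 F)
    {p : EuclideanSpace ℝ (Fin n)} (hp : F p = 1) {d : ℝ} (hd : 0 < d)
    {W η : EuclideanSpace ℝ (Fin n)} (hη : fderiv ℝ (flux F) p η = W) :
    HasJet (fun t => dualNorm F (d • flux F p + t • W)) ⟪p, W⟫ ((⟪η, W⟫ - ⟪p, W⟫ ^ 2) / d) := by
  have hp0 : p ≠ 0 := by
    rintro rfl
    rw [hF.map_zero] at hp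
    exact zero_ne_one hp
  have hdp : d • p ≠ 0 := smul_ne_zero hd.ne' hp0
  have hz0 : flux F (d • p) ≠ 0 := fun h => hdp (hF.flux_eq_zero h)
  have hFdp : F (d • p) = d := by rw [hF.homog, hp, abs_of_pos hd, mul_one]
  have hline : ∀ t, HasDerivAt (fun t : ℝ => flux F (d • p) + t • W) W t := fun t => by
    simpa using ((hasDerivAt_id t).smul_const W).const_add (flux F (d • p))
  have hgrad : ∀ z : EuclideanSpace ℝ (Fin n), z ≠ 0 →
      HasGradientAt (dualNorm F) ((dualNorm F z)⁻¹ • fluxInv F z) z := by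
    intro z hz
    obtain ⟨ξ, hξ⟩ : ∃ ξ, fluxInv F z = ξ := ⟨_, rfl⟩
    have h := hF.flux_fluxInv z
    rw [hξ] at h
    have hξ0 : ξ ≠ 0 := by
      rintro rfl
      exact hz (by rw [← h, hF.flux_zero])
    have := hF.hasGradientAt_dualNorm hξ0
    rwa [h, ← hξ] at this
  have hpg : gradient (dualNorm F) (flux F (d • p)) = p := by
    rw [(hF.hasGradientAt_dualNorm hdp).gradient, hFdp, smul_smul, inv_mul_cancel₀ hd.ne',
      one_smul]
  have hC1 : ContDiffAt ℝ 1 (gradient (dualNorm F)) (flux F (d • p)) :=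
    (InnerProductSpace.toDual ℝ _).symm.contDiff.contDiffAt.comp _
      ((hF.contDiffAt_dualNorm hz0).fderiv_right (by norm_num))
  have hDg := (hC1.differentiableAt (by norm_num)).hasFDerivAt
  set D := fderiv ℝ (gradient (dualNorm F)) (flux F (d • p))
  rw [← hF.flux_smul]
  have hev : ∀ᶠ z in 𝓝 (flux F (d • p)), z ≠ 0 := isOpen_compl_singleton.mem_nhds hz0
  have hN : ∀ z : EuclideanSpace ℝ (Fin n), z ≠ 0 →
      flux F (dualNorm F z • gradient (dualNorm F) z) = z := by
    intro z hz
    rw [(hgrad z hz).gradient, smul_smul,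
      mul_inv_cancel₀ (hF.isMinkowskiNorm_dualNorm.pos z hz).ne', one_smul, hF.flux_fluxInv]
  have hDW : D W = d⁻¹ • (η - ⟪p, W⟫ • p) := by
    have h1 : HasFDerivAt (fun z => dualNorm F z • gradient (dualNorm F) z)
        (d • D + (InnerProductSpace.toDual ℝ _ p).smulRight p) (flux F (d • p)) := by
      have h2 := (hF.hasGradientAt_dualNorm hdp).hasFDerivAt.smul hDg
      rw [← (hF.hasGradientAt_dualNorm hdp).gradient, hpg, hF.dualNorm_flux, hFdp] at h2
      exact h2
    have h2 : HasFDerivAt (flux F) (fderiv ℝ (flux F) p)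
        (dualNorm F (flux F (d • p)) • gradient (dualNorm F) (flux F (d • p))) := by
      rw [hpg, hF.dualNorm_flux, hFdp, ← hF.fderiv_flux_smul hp0 hd.ne']
      exact hF.hasFDerivAt_flux hdp
    have h3 := HasFDerivAt.comp (flux F (d • p))
      (f := fun z => dualNorm F z • gradient (dualNorm F) z) h2 h1
    have h4 := h3.unique ((hasFDerivAt_id (flux F (d • p))).congr_of_eventuallyEq (by
      filter_upwards [hev] with z hz using hN z hz))
    have h5 := DFunLike.congr_fun h4 W
    have h6 : d • D W + ⟪p, W⟫ • p = η := by
      apply hF.fderiv_flux_injective hp0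
      rw [hη]
      exact h5
    rw [← h6, add_sub_cancel_right, smul_smul, inv_mul_cancel₀ hd.ne', one_smul]
  refine ⟨fun t => ⟪gradient (dualNorm F) (flux F (d • p) + t • W), W⟫, ?_, ?_, ?_⟩
  · simp only [zero_smul, add_zero, hpg]
  · have h1 : Tendsto (fun t : ℝ => flux F (d • p) + t • W) (𝓝[≥] 0) (𝓝 (flux F (d • p))) := by
      have := (hline 0).continuousAt.tendsto.mono_left (nhdsWithin_le_nhds (s := Ici 0))
      simpa using this
    filter_upwards [h1.eventually hev] with t ht
    have h2 := (hgrad _ ht)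
    rw [← h2.gradient] at h2
    have h3 := h2.hasFDerivAt.comp_hasDerivAt t (hline t)
    rw [InnerProductSpace.toDual_apply_apply] at h3
    exact h3.hasDerivWithinAt
  · have h1 : HasFDerivAt (gradient (dualNorm F)) D (flux F (d • p) + (0 : ℝ) • W) := by
      simpa using hDg
    have h2 := (h1.comp_hasDerivAt 0 (hline 0)).inner ℝ (hasDerivAt_const (0 : ℝ) W)
    refine h2.hasDerivWithinAt.congr_deriv ?_
    rw [hDW, inner_smul_left, inner_sub_left, inner_smul_left]
    simp only [inner_zero_right, conj_trivial, zero_add]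
    ring

lemma exists_unit_flux (hF : IsStronglyConvexMinkowskiNormC3 F) {z : EuclideanSpace ℝ (Fin n)}
    (hz : 0 < dualNorm F z) : ∃ p, F p = 1 ∧ dualNorm F z • flux F p = z := by
  refine ⟨(dualNorm F z)⁻¹ • fluxInv F z, ?_, ?_⟩
  · rw [hF.homog, abs_of_pos (inv_pos.2 hz)]
    exact inv_mul_cancel₀ hz.ne'
  · rw [hF.flux_smul, smul_smul, mul_inv_cancel₀ hz.ne', one_smul, hF.flux_fluxInv]

lemma exists_rightInverse_fderiv_flux (hF : IsStronglyConvexMinkowskiNormC3 F)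
    {p : EuclideanSpace ℝ (Fin n)} (hp : p ≠ 0) :
    ∃ B : EuclideanSpace ℝ (Fin n) →L[ℝ] EuclideanSpace ℝ (Fin n),
      ∀ W, fderiv ℝ (flux F) p (B W) = W := by
  set A := (LinearEquiv.ofInjectiveEndo (fderiv ℝ (flux F) p :
    EuclideanSpace ℝ (Fin n) →ₗ[ℝ] EuclideanSpace ℝ (Fin n))
    (hF.fderiv_flux_injective hp)).toContinuousLinearEquiv
  exact ⟨A.symm, fun W => A.apply_symm_apply W⟩

end IsStronglyConvexMinkowskiNormC3

section Normals

variable {n : ℕ} {Ω : Set (EuclideanSpace ℝ (Fin n))} {x y ν W : EuclideanSpace ℝ (Fin n)}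

/-- `ν` is an outward normal (possibly zero) of `K` at `x`. -/
def IsOutwardNormal (K : Set (EuclideanSpace ℝ (Fin n))) (x ν : EuclideanSpace ℝ (Fin n)) : Prop :=
  ∀ y ∈ K, ⟪ν, y - x⟫ ≤ 0

/-- The segments from `x` in direction `W` stay in `K` for a short time. -/
def IsAdmissible (K : Set (EuclideanSpace ℝ (Fin n))) (x W : EuclideanSpace ℝ (Fin n)) : Prop :=
  ∀ᶠ t : ℝ in 𝓝[≥] 0, x + t • W ∈ K

lemma IsAdmissible.smul {K : Set (EuclideanSpace ℝ (Fin n))} (h : IsAdmissible K x W) {β : ℝ}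
    (hβ : 0 ≤ β) : IsAdmissible K x (β • W) := by
  have h1 : Tendsto (fun t : ℝ => t * β) (𝓝[≥] 0) (𝓝[≥] 0) := by
    refine tendsto_nhdsWithin_iff.2 ⟨?_, ?_⟩
    · have : Continuous fun t : ℝ => t * β := by fun_prop
      simpa using (this.tendsto 0).mono_left nhdsWithin_le_nhds
    · filter_upwards [self_mem_nhdsWithin] with t ht using mul_nonneg ht hβ
  have h2 := h1.eventually h
  simpa only [IsAdmissible, smul_smul] using h2

lemma isAdmissible_of_mem (hop : IsOpen Ω) (hx : x ∈ Ω) : IsAdmissible (closure Ω) x W := by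
  have h : Tendsto (fun t : ℝ => x + t • W) (𝓝[≥] 0) (𝓝 x) := by
    have : Continuous fun t : ℝ => x + t • W := by fun_prop
    simpa using (this.tendsto 0).mono_left nhdsWithin_le_nhds
  filter_upwards [h.eventually (hop.mem_nhds hx)] with t ht using subset_closure ht

lemma isAdmissible_sub {K : Set (EuclideanSpace ℝ (Fin n))} (hK : Convex ℝ K) (hx : x ∈ K)
    (hy : y ∈ K) : IsAdmissible K x (y - x) := by
  have h : ∀ᶠ t : ℝ in 𝓝[≥] 0, t ≤ 1 := nhdsWithin_le_nhds (Iic_mem_nhds one_pos)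
  filter_upwards [self_mem_nhdsWithin, h] with t h0 h1
  have := hK hx hy (sub_nonneg.2 h1) h0 (by ring)
  rwa [show x + t • (y - x) = (1 - t) • x + t • y by module]

lemma IsOutwardNormal.eq_zero (hop : IsOpen Ω) (hx : x ∈ Ω) (h : IsOutwardNormal (closure Ω) x ν) :
    ν = 0 := by
  obtain ⟨t, ht, h0⟩ := (((isAdmissible_of_mem (W := ν) hop hx).filter_mono
    (nhdsWithin_mono _ Ioi_subset_Ici_self)).and self_mem_nhdsWithin).exists
  have h0 : 0 < t := h0
  have h1 := h _ ht
  rw [add_sub_cancel_left, inner_smul_right, real_inner_self_eq_norm_sq] at h1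
  by_contra hν
  have := norm_pos_iff.2 hν
  have : 0 < t * ‖ν‖ ^ 2 := by positivity
  linarith

lemma exists_isOutwardNormal (hne : Ω.Nonempty) (hop : IsOpen Ω) (hconv : Convex ℝ Ω)
    (hx : x ∉ Ω) : ∃ ν ≠ 0, IsOutwardNormal (closure Ω) x ν := by
  obtain ⟨f, hf⟩ := geometric_hahn_banach_open_point hconv hop hx
  obtain ⟨ν, rfl⟩ := (InnerProductSpace.toDual ℝ (EuclideanSpace ℝ (Fin n))).surjective f
  simp only [InnerProductSpace.toDual_apply_apply] at hf
  refine ⟨ν, ?_, fun y hy => ?_⟩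
  · rintro rfl
    obtain ⟨z, hz⟩ := hne
    simpa using hf z hz
  · have h1 : closure Ω ⊆ {y | ⟪ν, y - x⟫ ≤ 0} := by
      refine closure_minimal (fun y hy => ?_) (isClosed_le (by fun_prop) continuous_const)
      have := hf y hy
      simp only [mem_ofPred_eq, inner_sub_right]
      linarith
    exact h1 hy

lemma IsOutwardNormal.inner_nonpos {K : Set (EuclideanSpace ℝ (Fin n))}
    (h : IsOutwardNormal K x ν) (hW : IsAdmissible K x W) : ⟪ν, W⟫ ≤ 0 := by
  obtain ⟨t, ht, h0⟩ := ((hW.filter_mono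
    (nhdsWithin_mono _ Ioi_subset_Ici_self)).and self_mem_nhdsWithin).exists
  have h0 : 0 < t := h0
  have h1 := h _ ht
  rw [add_sub_cancel_left, inner_smul_right] at h1
  by_contra! h2
  have := mul_pos h0 h2
  linarith

lemma IsOutwardNormal.isAdmissible (hop : IsOpen Ω) (hsb : HasSmoothBoundary Ω)
    (hx : x ∈ closure Ω) (hν : ν ≠ 0) (h : IsOutwardNormal (closure Ω) x ν) (hW : ⟪ν, W⟫ < 0) :
    IsAdmissible (closure Ω) x W := by
  have hxΩ : x ∉ Ω := fun hxΩ => hν (h.eq_zero hop hxΩ)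
  have hxf : x ∈ frontier Ω := by rw [hop.frontier_eq]; exact ⟨hx, hxΩ⟩
  obtain ⟨U, hU, f, hf, hfU, hdf⟩ := hsb x hxf
  have hfx : f x = 0 := by
    refine le_antisymm ?_ (not_lt.1 fun h => hxΩ ((hfU x (mem_of_mem_nhds hU)).2 h))
    have h1 : ∃ᶠ y in 𝓝 x, f y ≤ 0 :=
      ((mem_closure_iff_frequently.1 hx).and_eventually hU).mono fun y hy =>
        ((hfU y hy.2).1 hy.1).le
    exact isClosed_Iic.mem_of_frequently_of_tendsto h1 hf.continuous.continuousAt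
  have hfd : HasFDerivAt f (fderiv ℝ f x) x :=
    (hf.differentiable (by simp)).differentiableAt.hasFDerivAt
  have key : ∀ W, fderiv ℝ f x W < 0 → IsAdmissible (closure Ω) x W := by
    intro W hW
    have hl : HasDerivAt (fun t : ℝ => x + t • W) W 0 := by
      simpa using ((hasDerivAt_id (0 : ℝ)).smul_const W).const_add x
    have hfd' : HasFDerivAt f (fderiv ℝ f x) (x + (0 : ℝ) • W) := by simpa using hfd
    have h1 := (hfd'.comp_hasDerivAt 0 hl).hasDerivWithinAt (s := Ioi 0)
    rw [hasDerivWithinAt_iff_tendsto_slope' (by simp)] at h1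
    have hl' : Tendsto (fun t : ℝ => x + t • W) (𝓝[>] 0) (𝓝 x) := by
      have := hl.continuousAt.tendsto.mono_left (nhdsWithin_le_nhds (s := Ioi 0))
      simpa using this
    have h2 : ∀ᶠ t : ℝ in 𝓝[>] 0, x + t • W ∈ closure Ω := by
      filter_upwards [h1.eventually (gt_mem_nhds hW), self_mem_nhdsWithin, hl'.eventually hU]
        with t h3 h4 h5
      rw [slope_def_field] at h3
      simp only [Function.comp, zero_smul, add_zero, hfx, sub_zero] at h3
      exact subset_closure ((hfU _ h5).2 (not_le.1 fun h => h3.not_ge (div_nonneg h (le_of_lt h4))))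
    rw [IsAdmissible, ← Ioi_insert, nhdsWithin_insert]
    exact eventually_sup.2 ⟨by simpa using hx, h2⟩
  by_cases hd : fderiv ℝ f x W < 0
  · exact key W hd
  exfalso
  obtain ⟨A, hA⟩ : ∃ A, fderiv ℝ f x A < 0 := by
    by_contra! hA
    refine hdf x (mem_of_mem_nhds hU) hxf ?_
    ext A
    have h1 := hA A
    have h2 := hA (-A)
    rw [map_neg] at h2
    rw [_root_.zero_apply]
    linarith
  have h1 : ∀ ε : ℝ, 0 < ε → ⟪ν, -W + ε • A⟫ ≤ 0 := fun ε hε => by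
    refine h.inner_nonpos (key _ ?_)
    rw [map_add, map_neg, map_smul, smul_eq_mul]
    have := mul_neg_of_pos_of_neg hε hA
    linarith
  have h2 : Tendsto (fun ε : ℝ => ⟪ν, -W + ε • A⟫) (𝓝[>] 0) (𝓝 ⟪ν, -W⟫) := by
    have : Continuous fun ε : ℝ => ⟪ν, -W + ε • A⟫ := by fun_prop
    simpa using (this.tendsto 0).mono_left (nhdsWithin_le_nhds (s := Ioi 0))
  have h3 := le_of_tendsto h2 (by filter_upwards [self_mem_nhdsWithin] with ε hε using h1 ε hε)
  rw [inner_neg_right] at h3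
  linarith

/-- If two points have the same outward normals, an even continuous function that is nonpositive
on directions admissible at both points is nonpositive. -/
lemma nonpos_of_isAdmissible (hne : Ω.Nonempty) (hop : IsOpen Ω) (hconv : Convex ℝ Ω)
    (hsb : HasSmoothBoundary Ω) (hx : x ∈ closure Ω) (hy : y ∈ closure Ω)
    (hxy : ∀ ν, IsOutwardNormal (closure Ω) x ν ↔ IsOutwardNormal (closure Ω) y ν)
    {q : EuclideanSpace ℝ (Fin n) → ℝ} (hqc : Continuous q) (hqe : ∀ W, q (-W) = q W)
    (hq : ∀ W, IsAdmissible (closure Ω) x W → IsAdmissible (closure Ω) y W → q W ≤ 0)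
    (W : EuclideanSpace ℝ (Fin n)) : q W ≤ 0 := by
  by_cases hx' : x ∈ Ω
  · have hy' : y ∈ Ω := by
      by_contra hy'
      obtain ⟨ν, hν, h⟩ := exists_isOutwardNormal hne hop hconv hy'
      exact hν (((hxy ν).2 h).eq_zero hop hx')
    exact hq W (isAdmissible_of_mem hop hx') (isAdmissible_of_mem hop hy')
  obtain ⟨ν, hν, h⟩ := exists_isOutwardNormal hne hop hconv hx'
  have key : ∀ W, ⟪ν, W⟫ < 0 → q W ≤ 0 := fun W hW =>
    hq W (h.isAdmissible hop hsb hx hν hW) (((hxy ν).1 h).isAdmissible hop hsb hy hν hW)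
  rcases lt_trichotomy ⟪ν, W⟫ 0 with h0 | h0 | h0
  · exact key W h0
  · have h2 : Tendsto (fun ε : ℝ => q (W - ε • ν)) (𝓝[>] 0) (𝓝 (q W)) := by
      have : Continuous fun ε : ℝ => q (W - ε • ν) := by fun_prop
      simpa using (this.tendsto 0).mono_left (nhdsWithin_le_nhds (s := Ioi 0))
    refine le_of_tendsto h2 ?_
    filter_upwards [self_mem_nhdsWithin] with ε hε
    refine key _ ?_
    have hε : 0 < ε := hε
    have := norm_pos_iff.2 hν
    rw [inner_sub_right, inner_smul_right, h0, real_inner_self_eq_norm_sq]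
    have : 0 < ε * ‖ν‖ ^ 2 := by positivity
    linarith
  · rw [← hqe]
    refine key _ ?_
    rw [inner_neg_right]
    linarith

end Normals

/-- Up-to-the-boundary regularity of an eigenfunction `u` on `K`, with gradient `G` and
Hessian `H` relative to `K`. -/
structure IsRegularEigenfunction {n : ℕ} (F : EuclideanSpace ℝ (Fin n) → ℝ)
    (K : Set (EuclideanSpace ℝ (Fin n))) (lam : ℝ) (u : EuclideanSpace ℝ (Fin n) → ℝ)
    (G : EuclideanSpace ℝ (Fin n) → EuclideanSpace ℝ (Fin n))
    (H : EuclideanSpace ℝ (Fin n) → EuclideanSpace ℝ (Fin n) →L[ℝ] EuclideanSpace ℝ (Fin n)) :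
    Prop where
  hasGradient : ∀ x ∈ K, HasFDerivWithinAt u (innerSL ℝ (G x)) K x
  continuousOn : ContinuousOn G K
  inner_normal : ∀ x ∈ K, ∀ ν, IsOutwardNormal K x ν → ⟪flux F (G x), ν⟫ = 0
  hasHessian : ∀ x ∈ K, G x ≠ 0 → HasFDerivWithinAt G (H x) K x
  eqn : ∀ x ∈ K, G x ≠ 0 → ∑ i, ∑ j, aCoeff F i j (G x) *
    ⟪H x (EuclideanSpace.single j 1), EuclideanSpace.single i 1⟫ = -lam * u x

section

variable {n : ℕ} {F : EuclideanSpace ℝ (Fin n) → ℝ} {Ω : Set (EuclideanSpace ℝ (Fin n))}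
  {lam : ℝ} {u : EuclideanSpace ℝ (Fin n) → ℝ}

lemma IsNeumannEigenfunction.exists_isRegularEigenfunction
    (hu : IsNeumannEigenfunction F Ω lam u) (hF : IsStronglyConvexMinkowskiNormC3 F)
    (hne : Ω.Nonempty) (hop : IsOpen Ω) (hconv : Convex ℝ Ω) :
    ∃ G H, IsRegularEigenfunction F (closure Ω) lam u G H := by
  have hKu : UniqueDiffOn ℝ (closure Ω) := by
    refine uniqueDiffOn_convex hconv.closure (hne.mono ?_)
    exact hop.subset_interior_iff.2 subset_closure
  have hΩn : ∀ x ∈ Ω, closure Ω ∈ 𝓝 x := fun x hx =>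
    mem_of_superset (hop.mem_nhds hx) subset_closure
  set G := gradientWithin u (closure Ω) with hG
  have hGc : ContinuousOn G (closure Ω) :=
    (InnerProductSpace.toDual ℝ _).symm.continuous.comp_continuousOn
      (hu.contDiff1.continuousOn_fderivWithin hKu le_rfl)
  have hgrad : ∀ x ∈ closure Ω, HasFDerivWithinAt u (innerSL ℝ (G x)) (closure Ω) x := by
    intro x hx
    exact ((hu.contDiff1.differentiableOn (by norm_num)) x hx).hasGradientWithinAt
  have hGd : ∀ x ∈ closure Ω, DifferentiableAt ℝ u x → gradient u x = G x := by
    intro x hx hd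
    rw [hG, gradient, gradientWithin, hd.fderivWithin (hKu x hx)]
  have hGΩ : ∀ x ∈ Ω, gradient u x = G x := fun x hx =>
    hGd x (subset_closure hx)
      ((hgrad x (subset_closure hx)).hasFDerivAt (hΩn x hx)).differentiableAt
  have hGK : ∀ x ∈ closure Ω, gradient u x = G x := by
    have h1 : EqOn (fun x => F (gradient u x) • gradient F (gradient u x))
        (fun x => flux F (G x)) (closure Ω) := by
      refine EqOn.of_subset_closure (s := Ω) (fun x hx => ?_) hu.fluxCont
        (hF.continuous_flux.comp_continuousOn hGc) subset_closure subset_rfl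
      simp only [hGΩ x hx, hF.flux_eq_smul_gradient]
    intro x hx
    by_cases hd : DifferentiableAt ℝ u x
    · exact hGd x hx hd
    · have h2 : gradient u x = 0 := by
        rw [gradient, fderiv_zero_of_not_differentiableAt hd, map_zero]
      have h3 := h1 hx
      simp only [hF.flux_eq_smul_gradient, h2, hF.flux_zero] at h3
      rw [h2, hF.flux_eq_zero h3.symm]
  obtain ⟨U, hU, hUS⟩ := (continuousOn_iff'.1 hGc) {0}ᶜ isOpen_compl_singleton
  have hmemU : ∀ x ∈ closure Ω, (G x ≠ 0 ↔ x ∈ U) := by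
    intro x hx
    have := Set.ext_iff.1 hUS x
    simpa [hx] using this
  have hS : {x ∈ closure Ω | gradient u x ≠ 0} = closure Ω ∩ U := by
    ext x
    refine and_congr_right fun hx => ?_
    rw [hGK x hx, hmemU x hx]
  have hSu : UniqueDiffOn ℝ (closure Ω ∩ U) := hKu.inter hU
  have hC2 := hu.contDiff2
  rw [hS] at hC2
  have hGS : EqOn G (gradientWithin u (closure Ω ∩ U)) (closure Ω ∩ U) := by
    intro x hx
    rw [hG, gradientWithin, gradientWithin, fderivWithin_inter (hU.mem_nhds hx.2)]
  have hG1 : ContDiffOn ℝ 1 G (closure Ω ∩ U) :=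
    ((InnerProductSpace.toDual ℝ _).symm.contDiff.comp_contDiffOn
      (hC2.fderivWithin hSu (by norm_num))).congr hGS
  refine ⟨G, fderivWithin ℝ G (closure Ω ∩ U), hgrad, hGc, fun x hx ν hν => ?_,
    fun x hx hGx => ?_, fun x hx hGx => ?_⟩
  · by_cases hGx : G x = 0
    · rw [hGx, hF.flux_zero, inner_zero_left]
    by_cases hxΩ : x ∈ Ω
    · rw [hν.eq_zero hop hxΩ, inner_zero_right]
    by_cases hν0 : ν = 0
    · rw [hν0, inner_zero_right]
    have h1 : x ∈ frontier Ω := by rw [hop.frontier_eq]; exact ⟨hx, hxΩ⟩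
    have h2 := hu.neumann x h1 (by rwa [hGK x hx]) ν hν0 hν
    rw [hGK x hx] at h2
    rw [← hF.flux_eq_smul_gradient, inner_smul_left, h2, mul_zero]
  · have hxU := (hmemU x hx).1 hGx
    exact (hasFDerivWithinAt_inter (hU.mem_nhds hxU)).1
      ((hG1.differentiableOn (by norm_num)) x ⟨hx, hxU⟩).hasFDerivWithinAt
  · have hHc := hG1.continuousOn_fderivWithin hSu le_rfl
    have h1 : EqOn (fun x => ∑ i, ∑ j, aCoeff F i j (G x) *
        ⟪fderivWithin ℝ G (closure Ω ∩ U) x (EuclideanSpace.single j 1),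
          EuclideanSpace.single i 1⟫) (fun x => -lam * u x) (closure Ω ∩ U) := by
      refine EqOn.of_subset_closure (s := Ω ∩ U) (fun x hx => ?_) ?_ ?_
        (inter_subset_inter_left _ subset_closure) ?_
      · have hxK := subset_closure hx.1
        rw [← hu.eqn x hx.1 (by rw [hGK x hxK]; exact (hmemU x hxK).2 hx.2)]
        simp only [hGK x hxK]
        have hn : Ω ∩ U ∈ 𝓝 x := (hop.inter hU).mem_nhds hx
        have hn' : closure Ω ∩ U ∈ 𝓝 x :=
          mem_of_superset hn (inter_subset_inter_left _ subset_closure)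
        have hGx : HasFDerivAt G (fderivWithin ℝ G (closure Ω ∩ U) x) x :=
          ((hG1.differentiableOn (by norm_num)) x
            ⟨hxK, hx.2⟩).hasFDerivWithinAt.hasFDerivAt hn'
        refine Finset.sum_congr rfl fun i _ => Finset.sum_congr rfl fun j _ => ?_
        have h2 : pd u i =ᶠ[𝓝 x] fun y => ⟪G y, EuclideanSpace.single i (1 : ℝ)⟫ := by
          filter_upwards [hn] with y hy
          rw [pd, ((hgrad y (subset_closure hy.1)).hasFDerivAt (hΩn y hy.1)).fderiv,
            innerSL_apply_apply]
        have h3 := (hGx.inner ℝ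
          (hasFDerivAt_const (EuclideanSpace.single i (1 : ℝ)) x)).congr_of_eventuallyEq h2
        rw [pd, h3.fderiv]
        simp
      · refine continuousOn_finsetSum _ fun i _ => continuousOn_finsetSum _ fun j _ => ?_
        refine ContinuousOn.mul ((hF.continuousOn_aCoeff i j).comp (hGc.mono inter_subset_left)
          fun x hx => (hmemU x hx.1).2 hx.2) ?_
        exact (hHc.clm_apply continuousOn_const).inner continuousOn_const
      · exact continuousOn_const.mul (hu.contDiff1.continuousOn.mono inter_subset_left)
      · rw [inter_comm, inter_comm Ω]
        exact hU.inter_closure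
    exact h1 ⟨hx, (hmemU x hx).1 hGx⟩

end

namespace IsRegularEigenfunction

variable {n : ℕ} {F : EuclideanSpace ℝ (Fin n) → ℝ} {K : Set (EuclideanSpace ℝ (Fin n))}
  {lam : ℝ} {u : EuclideanSpace ℝ (Fin n) → ℝ}
  {G : EuclideanSpace ℝ (Fin n) → EuclideanSpace ℝ (Fin n)}
  {H : EuclideanSpace ℝ (Fin n) → EuclideanSpace ℝ (Fin n) →L[ℝ] EuclideanSpace ℝ (Fin n)}
  {x W : EuclideanSpace ℝ (Fin n)}

lemma hasDerivWithinAt_line (h : IsRegularEigenfunction F K lam u G H)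
    (hW : IsAdmissible K x W) : ∀ᶠ t : ℝ in 𝓝[≥] 0,
      HasDerivWithinAt (fun t : ℝ => u (x + t • W)) ⟪G (x + t • W), W⟫ (Ici 0) t := by
  obtain ⟨δ, hδ, hsub⟩ := mem_nhdsGE_iff_exists_Ico_subset.1 hW
  have hδ : 0 < δ := hδ
  filter_upwards [Ico_mem_nhdsGE hδ] with t ht
  have h1 : HasDerivWithinAt (fun t : ℝ => x + t • W) W (Ico 0 δ) t := by
    simpa using (((hasDerivAt_id t).smul_const W).const_add x).hasDerivWithinAt
  have h2 := (h.hasGradient _ (hsub ht)).comp_hasDerivWithinAt t h1 fun s hs => hsub hs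
  rw [innerSL_apply_apply] at h2
  refine h2.mono_of_mem_nhdsWithin ?_
  rw [← Ici_inter_Iio]
  exact inter_mem_nhdsWithin _ (Iio_mem_nhds ht.2)

lemma hasDerivWithinAt_zero (h : IsRegularEigenfunction F K lam u G H)
    (hW : IsAdmissible K x W) :
    HasDerivWithinAt (fun t : ℝ => u (x + t • W)) ⟪G x, W⟫ (Ici 0) 0 := by
  have := (h.hasDerivWithinAt_line hW).self_of_nhdsWithin (mem_Ici.2 le_rfl)
  simpa using this

lemma hasJet (h : IsRegularEigenfunction F K lam u G H) (hx : x ∈ K) (hG : G x ≠ 0)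
    (hW : IsAdmissible K x W) :
    HasJet (fun t : ℝ => u (x + t • W)) ⟪G x, W⟫ ⟪H x W, W⟫ := by
  refine ⟨fun t => ⟪G (x + t • W), W⟫, by simp, h.hasDerivWithinAt_line hW, ?_⟩
  obtain ⟨δ, hδ, hsub⟩ := mem_nhdsGE_iff_exists_Ico_subset.1 hW
  have hδ : 0 < δ := hδ
  have h1 : HasDerivWithinAt (fun t : ℝ => x + t • W) W (Ico 0 δ) 0 := by
    simpa using (((hasDerivAt_id (0 : ℝ)).smul_const W).const_add x).hasDerivWithinAt
  have h0 : HasFDerivWithinAt G (H x) K (x + (0 : ℝ) • W) := by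
    simpa using h.hasHessian x hx hG
  have h2 := (h0.comp_hasDerivWithinAt 0 h1 fun s hs => hsub hs).inner ℝ
    (hasDerivWithinAt_const (0 : ℝ) _ W)
  have h3 : HasDerivWithinAt (fun t : ℝ => ⟪G (x + t • W), W⟫) ⟪H x W, W⟫ (Ico 0 δ) 0 := by
    refine h2.congr_deriv ?_
    simp
  refine h3.mono_of_mem_nhdsWithin (Ico_mem_nhdsGE hδ)

end IsRegularEigenfunction

/-- `φ` inverts the model solution on `[0, S]`. -/
structure IsProfile (lam k S : ℝ) (φ : ℝ → ℝ) : Prop where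
  one_le : 1 ≤ k
  pos : 0 < S
  deriv_pos : ∀ s ∈ Ioc 0 S, 0 < modelDeriv lam k s
  strictMonoOn : StrictMonoOn φ (Icc (-1) (modelSol lam k S))
  continuousOn : ContinuousOn φ (Icc (-1) (modelSol lam k S))
  apply_modelSol : ∀ s ∈ Icc 0 S, φ (modelSol lam k s) = s
  mem_Icc : ∀ τ ∈ Icc (-1) (modelSol lam k S), φ τ ∈ Icc 0 S
  modelSol_apply : ∀ τ ∈ Icc (-1) (modelSol lam k S), modelSol lam k (φ τ) = τ
  mem_Ioo : ∀ τ ∈ Ioo (-1) (modelSol lam k S), φ τ ∈ Ioo 0 S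
  hasDerivAt : ∀ τ ∈ Ioo (-1) (modelSol lam k S), HasDerivAt φ (modelDeriv lam k (φ τ))⁻¹ τ

lemma exists_isProfile {lam k S : ℝ} (hk : 1 ≤ k) (hS : 0 < S)
    (hpos : ∀ s ∈ Ioc 0 S, 0 < modelDeriv lam k s) : ∃ φ, IsProfile lam k S φ := by
  set V := modelSol lam k with hV
  have hVc : Continuous V := continuous_modelSol hk
  have hV0 : V 0 = -1 := modelSol_zero lam k
  have hmono : StrictMonoOn V (Icc 0 S) := by
    refine strictMonoOn_of_deriv_pos (convex_Icc _ _) hVc.continuousOn fun s hs => ?_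
    rw [interior_Icc] at hs
    rw [(hasDerivAt_modelSol hk s).deriv]
    exact hpos s ⟨hs.1, hs.2.le⟩
  have himg : V '' Icc 0 S = Icc (-1) (V S) := by
    rw [← hV0]
    refine Subset.antisymm ?_ (intermediate_value_Icc hS.le hVc.continuousOn)
    rintro _ ⟨s, hs, rfl⟩
    exact ⟨hmono.monotoneOn (left_mem_Icc.2 hS.le) hs hs.1,
      hmono.monotoneOn hs (right_mem_Icc.2 hS.le) hs.2⟩
  set φ := Function.invFunOn V (Icc 0 S) with hφ
  have hmem : ∀ τ ∈ Icc (-1) (V S), φ τ ∈ Icc 0 S := fun τ hτ =>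
    Function.invFunOn_mem (by rwa [← himg] at hτ)
  have happ : ∀ τ ∈ Icc (-1) (V S), V (φ τ) = τ := fun τ hτ =>
    Function.invFunOn_eq (by rwa [← himg] at hτ)
  have hleft : ∀ s ∈ Icc 0 S, φ (V s) = s := fun s hs =>
    hmono.injOn (hmem _ (himg ▸ mem_image_of_mem V hs)) hs (happ _ (himg ▸ mem_image_of_mem V hs))
  have hφmono : StrictMonoOn φ (Icc (-1) (V S)) := by
    intro a ha b hb hab
    rw [← hmono.lt_iff_lt (hmem a ha) (hmem b hb), happ a ha, happ b hb]
    exact hab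
  have hφc : ContinuousOn φ (Icc (-1) (V S)) := by
    have h1 := ((hmono.orderIso V (Icc 0 S)).trans
      (OrderIso.setCongr _ _ himg)).symm.continuous
    rw [continuousOn_iff_continuous_domRestrict]
    have h2 : (Icc (-1) (V S)).domRestrict φ = fun τ => (((hmono.orderIso V (Icc 0 S)).trans
      (OrderIso.setCongr _ _ himg)).symm τ : ℝ) := by
      ext τ
      have h3 := ((hmono.orderIso V (Icc 0 S)).trans
        (OrderIso.setCongr _ _ himg)).apply_symm_apply τ
      have h4 := congrArg Subtype.val h3
      change V _ = _ at h4
      rw [domRestrict_apply, ← h4]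
      exact hleft _ (Subtype.coe_prop _)
    rw [h2]
    exact continuous_subtype_val.comp h1
  have hIoo : ∀ τ ∈ Ioo (-1) (V S), φ τ ∈ Ioo 0 S := by
    intro τ hτ
    have hτ' := Ioo_subset_Icc_self hτ
    refine ⟨(hmem τ hτ').1.lt_of_ne fun h => ?_, (hmem τ hτ').2.lt_of_ne fun h => ?_⟩
    · have := happ τ hτ'
      rw [← h, hV0] at this
      exact hτ.1.ne this
    · have := happ τ hτ'
      rw [h] at this
      exact hτ.2.ne' this
  refine ⟨φ, hk, hS, hpos, hφmono, hφc, hleft, hmem, happ, hIoo, fun τ hτ => ?_⟩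
  have hnhds : Icc (-1) (V S) ∈ 𝓝 τ := Icc_mem_nhds hτ.1 hτ.2
  refine HasDerivAt.of_local_left_inverse (f := V) (hφc.continuousAt hnhds)
    (hasDerivAt_modelSol hk _) (hpos _ ⟨(hIoo τ hτ).1, (hIoo τ hτ).2.le⟩).ne' ?_
  filter_upwards [hnhds] with σ hσ using happ σ hσ

lemma IsProfile.hasDerivAt_inv {lam k S : ℝ} {φ : ℝ → ℝ} (h : IsProfile lam k S φ) {τ : ℝ}
    (hτ : τ ∈ Ioo (-1) (modelSol lam k S)) :
    HasDerivAt (fun τ => (modelDeriv lam k (φ τ))⁻¹)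
      (((k - 1) / φ τ + lam * τ / modelDeriv lam k (φ τ)) * (modelDeriv lam k (φ τ))⁻¹ ^ 2) τ := by
  have hs := h.mem_Ioo τ hτ
  have hpos := h.deriv_pos (φ τ) ⟨hs.1, hs.2.le⟩
  have h1 := (hasDerivAt_modelDeriv (lam := lam) h.one_le hs.1.ne').comp τ (h.hasDerivAt τ hτ)
  refine (h1.inv hpos.ne').congr_deriv ?_
  have hs0 := hs.1.ne'
  rw [h.modelSol_apply τ (Ioo_subset_Icc_self hτ)]
  simp only [Function.comp]
  field_simp
  ring

section

variable {n : ℕ} {F : EuclideanSpace ℝ (Fin n) → ℝ} {K : Set (EuclideanSpace ℝ (Fin n))}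
  {lam : ℝ} {u : EuclideanSpace ℝ (Fin n) → ℝ}
  {G : EuclideanSpace ℝ (Fin n) → EuclideanSpace ℝ (Fin n)}
  {H : EuclideanSpace ℝ (Fin n) → EuclideanSpace ℝ (Fin n) →L[ℝ] EuclideanSpace ℝ (Fin n)}
  {k S ε : ℝ} {φ : ℝ → ℝ} {x p W : EuclideanSpace ℝ (Fin n)}

lemma IsProfile.hasDerivWithinAt_line (hφ : IsProfile lam k S φ)
    (h : IsRegularEigenfunction F K lam u G H) (hW : IsAdmissible K x W)
    (hτ : ε * u x ∈ Ioo (-1) (modelSol lam k S)) :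
    HasDerivWithinAt (fun t : ℝ => φ (ε * u (x + t • W)))
      ⟪((modelDeriv lam k (φ (ε * u x)))⁻¹ * ε) • G x, W⟫ (Ici 0) 0 := by
  have h1 := (h.hasDerivWithinAt_zero hW).const_mul ε
  have h2 : HasDerivAt φ (modelDeriv lam k (φ (ε * u x)))⁻¹ (ε * u (x + (0 : ℝ) • W)) := by
    simpa using hφ.hasDerivAt _ hτ
  refine (h2.comp_hasDerivWithinAt 0 h1).congr_deriv ?_
  rw [inner_smul_left, conj_trivial]
  ring

/-- Second derivatives along lines of the composition of the profile with an eigenfunction, at a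
point where its gradient is `F`-unit. -/
lemma IsProfile.exists_hasJet_line (hφ : IsProfile lam k S φ)
    (hF : IsStronglyConvexMinkowskiNormC3 F) (h : IsRegularEigenfunction F K lam u G H)
    (hx : x ∈ K) (hτ : ε * u x ∈ Ioo (-1) (modelSol lam k S)) (hε : 0 < ε)
    (hp : ((modelDeriv lam k (φ (ε * u x)))⁻¹ * ε) • G x = p) (hp1 : F p = 1) :
    ∃ Q : EuclideanSpace ℝ (Fin n) → ℝ, Continuous Q ∧ (∀ (β : ℝ) W, Q (β • W) = β ^ 2 * Q W) ∧
      (∀ W, IsAdmissible K x W → HasJet (fun t : ℝ => φ (ε * u (x + t • W))) ⟪p, W⟫ (Q W)) ∧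
      ∀ W : Fin n → EuclideanSpace ℝ (Fin n),
        (∀ T : EuclideanSpace ℝ (Fin n) →L[ℝ] EuclideanSpace ℝ (Fin n),
        ∑ k, ⟪T (W k), W k⟫ = ∑ i, ∑ j, aCoeff F i j p *
          ⟪T (EuclideanSpace.single j 1), EuclideanSpace.single i 1⟫) →
        ∑ i, Q (W i) = (k - 1) / φ (ε * u x) := by
  have hs := hφ.mem_Ioo _ hτ
  have hD := hφ.deriv_pos _ ⟨hs.1, hs.2.le⟩
  set D := modelDeriv lam k (φ (ε * u x)) with hDdef
  set s := φ (ε * u x) with hsdef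
  have hp0 : p ≠ 0 := by
    rintro rfl
    rw [hF.map_zero] at hp1
    exact zero_ne_one hp1
  have hG : G x ≠ 0 := by
    intro h0
    rw [h0, smul_zero] at hp
    exact hp0 hp.symm
  refine ⟨fun W => ((k - 1) / s + lam * (ε * u x) / D) * ⟪p, W⟫ ^ 2 + D⁻¹ * ε * ⟪H x W, W⟫,
    by fun_prop, fun β W => ?_, fun W hW => ?_, fun W hW => ?_⟩
  · simp only [map_smul, inner_smul_left, inner_smul_right, conj_trivial]
    ring
  · have h1 := h.hasJet hx hG hW
    have h2 : HasJet (fun t : ℝ => ε * u (x + t • W)) (ε * ⟪G x, W⟫) (ε * ⟪H x W, W⟫) := by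
      obtain ⟨f', hf0, hf1, hf2⟩ := h1
      refine ⟨fun t => ε * f' t, by simp only [hf0], ?_, hf2.const_mul ε⟩
      filter_upwards [hf1] with t ht using ht.const_mul ε
    have h3 := h2.comp (φ := φ) (φ' := fun τ => (modelDeriv lam k (φ τ))⁻¹)
      (by
        simp only [zero_smul, add_zero]
        filter_upwards [Ioo_mem_nhds hτ.1 hτ.2] with τ hτ using hφ.hasDerivAt τ hτ)
      (by
        simp only [zero_smul, add_zero]
        exact hφ.hasDerivAt_inv hτ)
    simp only [zero_smul, add_zero] at h3
    rw [← hsdef, ← hDdef] at h3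
    convert h3 using 1
    · rw [← hp, inner_smul_left, conj_trivial]
      ring
    · simp only [← hp, inner_smul_left, conj_trivial]
      ring
  · have h1 := hF.sum_inner_frame_sq hp0 hW
    have h2 : ∀ i j, aCoeff F i j p = aCoeff F i j (G x) := fun i j => by
      rw [← hp, hF.aCoeff_smul hG (by positivity)]
    rw [Finset.sum_add_distrib, ← Finset.mul_sum, ← Finset.mul_sum, h1, hW (H x)]
    simp only [h2]
    rw [h.eqn x hx hG, hp1]
    field_simp
    ring

/-- If the composition of the profile with `ε * u` is Lipschitz for the dual norm with a constant
close to one, then it is Lipschitz with constant one. -/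
lemma IsProfile.lipschitz_improve {Ω : Set (EuclideanSpace ℝ (Fin n))} (hn : 1 ≤ n)
    (hφ : IsProfile lam k S φ) (hF : IsStronglyConvexMinkowskiNormC3 F) (hne : Ω.Nonempty)
    (hbd : Bornology.IsBounded Ω) (hop : IsOpen Ω) (hconv : Convex ℝ Ω)
    (hsb : HasSmoothBoundary Ω) (h : IsRegularEigenfunction F (closure Ω) lam u G H)
    (hε : 0 < ε) (hτ : ∀ x ∈ closure Ω, ε * u x ∈ Ioo (-1) (modelSol lam k S))
    {ρ : ℝ} (hρ : (n - 1) * ρ < k - 1)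
    (hlip : ∀ x ∈ closure Ω, ∀ y ∈ closure Ω,
      φ (ε * u y) - φ (ε * u x) ≤ ρ * dualNorm F (y - x)) :
    ∀ x ∈ closure Ω, ∀ y ∈ closure Ω, φ (ε * u y) - φ (ε * u x) ≤ dualNorm F (y - x) := by
  by_contra! hcon
  have hN := hF.isMinkowskiNorm_dualNorm
  have hK : IsCompact (closure Ω) := hbd.isCompact_closure
  have hψc : ContinuousOn (fun x => φ (ε * u x)) (closure Ω) :=
    hφ.continuousOn.comp (continuousOn_const.mul fun x hx =>
      (h.hasGradient x hx).continuousWithinAt) fun x hx => Ioo_subset_Icc_self (hτ x hx)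
  have hZc : ContinuousOn (fun z : EuclideanSpace ℝ (Fin n) × EuclideanSpace ℝ (Fin n) =>
      φ (ε * u z.2) - φ (ε * u z.1) - dualNorm F (z.2 - z.1)) (closure Ω ×ˢ closure Ω) := by
    refine ((hψc.comp continuousOn_snd fun z hz => hz.2).sub
      (hψc.comp continuousOn_fst fun z hz => hz.1)).sub ?_
    exact (hN.continuous.comp (continuous_snd.sub continuous_fst)).continuousOn
  obtain ⟨⟨x, y⟩, hxy, hmax⟩ := (hK.prod hK).exists_isMaxOn
    (hne.closure.prod hne.closure) hZc
  obtain ⟨hx : x ∈ closure Ω, hy : y ∈ closure Ω⟩ := hxy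
  have hmax' : ∀ x' ∈ closure Ω, ∀ y' ∈ closure Ω,
      φ (ε * u y') - φ (ε * u x') - dualNorm F (y' - x') ≤
        φ (ε * u y) - φ (ε * u x) - dualNorm F (y - x) := fun x' hx' y' hy' =>
    hmax (show (x', y') ∈ closure Ω ×ˢ closure Ω from ⟨hx', hy'⟩)
  have hZ : dualNorm F (y - x) < φ (ε * u y) - φ (ε * u x) := by
    obtain ⟨x', hx', y', hy', h'⟩ := hcon
    have := hmax' x' hx' y' hy'
    linarith
  have hd : 0 < dualNorm F (y - x) := by
    refine hN.pos _ fun h0 => ?_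
    rw [h0, hN.map_zero, sub_eq_zero.1 h0] at hZ
    linarith
  set d := dualNorm F (y - x) with hddef
  have hsx := (hφ.mem_Ioo _ (hτ x hx)).1
  have hsy := (hφ.mem_Ioo _ (hτ y hy)).1
  set sx := φ (ε * u x) with hsxdef
  set sy := φ (ε * u y) with hsydef
  obtain ⟨p, hp1, hp⟩ : ∃ p, F p = 1 ∧ d • flux F p = y - x := hF.exists_unit_flux hd
  have hp0 : p ≠ 0 := by
    rintro rfl
    rw [hF.map_zero] at hp1
    exact zero_ne_one hp1
  obtain ⟨B, hB⟩ := hF.exists_rightInverse_fderiv_flux hp0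
  have hDx : 0 < modelDeriv lam k sx :=
    hφ.deriv_pos _ ⟨hsx, (hφ.mem_Ioo _ (hτ x hx)).2.le⟩
  have hDy : 0 < modelDeriv lam k sy :=
    hφ.deriv_pos _ ⟨hsy, (hφ.mem_Ioo _ (hτ y hy)).2.le⟩
  have hnormal : ∀ x ∈ closure Ω, ∀ c : ℝ, ∀ ν, IsOutwardNormal (closure Ω) x ν →
      ⟪flux F (c • G x), ν⟫ = 0 := by
    intro x hx c ν hν
    rw [hF.flux_smul, inner_smul_left, h.inner_normal x hx ν hν, mul_zero]
  have hpy : ((modelDeriv lam k sy)⁻¹ * ε) • G y = p := by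
    set P := ((modelDeriv lam k sy)⁻¹ * ε) • G y with hP
    have h1 : IsOutwardNormal (closure Ω) y (P - p) := by
      intro z hz
      have hadm := isAdmissible_sub hconv.closure hy hz
      have h2 := (hφ.hasDerivWithinAt_line h hadm (hτ y hy)).sub
        (hF.hasJet_dualNorm hp1 hd (hB (z - y))).hasDerivWithinAt
      have h3 := h2.nonpos_of_eventually_le (by
        filter_upwards [hadm.filter_mono (nhdsWithin_mono _ Ioi_subset_Ici_self)] with t ht
        have := hmax' x hx _ ht
        simp only [Pi.sub_apply, zero_smul, add_zero, hp]
        rw [show y - x + t • (z - y) = y + t • (z - y) - x by abel]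
        linarith)
      rw [inner_sub_left]
      exact h3
    have h2 := hnormal y hy ((modelDeriv lam k sy)⁻¹ * ε) _ h1
    rw [← hP] at h2
    have h3 : 0 ≤ ⟪flux F p, P - p⟫ := by
      have := h1 x hx
      rw [← neg_sub y x, ← hp, inner_neg_right, inner_smul_right, real_inner_comm] at this
      by_contra! h4
      have := mul_neg_of_pos_of_neg hd h4
      linarith
    have h4 := hF.eq_zero_of_inner_flux hp0 h3 (by rw [add_sub_cancel]; exact h2.le)
    exact sub_eq_zero.1 h4
  have hpx : ((modelDeriv lam k sx)⁻¹ * ε) • G x = p := by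
    set P := ((modelDeriv lam k sx)⁻¹ * ε) • G x with hP
    have h1 : IsOutwardNormal (closure Ω) x (p - P) := by
      intro z hz
      have hadm := isAdmissible_sub hconv.closure hx hz
      have h2 := (hφ.hasDerivWithinAt_line h hadm (hτ x hx)).neg.sub
        (hF.hasJet_dualNorm hp1 hd (hB (-(z - x)))).hasDerivWithinAt
      have h3 := h2.nonpos_of_eventually_le (by
        filter_upwards [hadm.filter_mono (nhdsWithin_mono _ Ioi_subset_Ici_self)] with t ht
        have := hmax' _ ht y hy
        simp only [Pi.sub_apply, Pi.neg_apply, zero_smul, add_zero, hp]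
        rw [show y - x + t • -(z - x) = y - (x + t • (z - x)) by module]
        linarith)
      rw [inner_neg_right] at h3
      rw [inner_sub_left]
      linarith
    have h2 := hnormal x hx ((modelDeriv lam k sx)⁻¹ * ε) _ h1
    rw [← hP] at h2
    have h3 : 0 ≤ ⟪flux F p, P - p⟫ := by
      have := h1 y hy
      rw [← hp, inner_smul_right, real_inner_comm, ← neg_sub P p, inner_neg_right] at this
      by_contra! h4
      have := mul_neg_of_pos_of_neg hd h4
      linarith
    have h4 := hF.eq_zero_of_inner_flux hp0 h3 (by
      rw [add_sub_cancel, ← neg_sub p P, inner_neg_right, h2, neg_zero])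
    exact sub_eq_zero.1 h4
  have hsame : ∀ ν, IsOutwardNormal (closure Ω) x ν ↔ IsOutwardNormal (closure Ω) y ν := by
    refine fun ν => ⟨fun hν z hz => ?_, fun hν z hz => ?_⟩
    · have h1 := hnormal x hx ((modelDeriv lam k sx)⁻¹ * ε) ν hν
      have h2 := hν z hz
      rw [hpx, real_inner_comm] at h1
      rw [show z - y = z - x - (y - x) by abel, ← hp, inner_sub_right, inner_smul_right, h1]
      linarith
    · have h1 := hnormal y hy ((modelDeriv lam k sy)⁻¹ * ε) ν hν
      have h2 := hν z hz
      rw [hpy, real_inner_comm] at h1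
      rw [show z - x = z - y + (y - x) by abel, ← hp, inner_add_right, inner_smul_right, h1]
      linarith
  obtain ⟨Qx, hQxc, hQxs, hQxj, hQxf⟩ := hφ.exists_hasJet_line hF h hx (hτ x hx) hε hpx hp1
  obtain ⟨Qy, hQyc, hQys, hQyj, hQyf⟩ := hφ.exists_hasJet_line hF h hy (hτ y hy) hε hpy hp1
  have key := nonpos_of_isAdmissible hne hop hconv hsb hx hy hsame
    (q := fun W => sy ^ 2 * Qy W - sx ^ 2 * Qx W -
      (sy - sx) ^ 2 * (⟪B W, W⟫ - ⟪p, W⟫ ^ 2) / d) (by fun_prop)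
    (fun W => by
      have h1 := hQxs (-1) W
      have h2 := hQys (-1) W
      rw [neg_one_smul] at h1 h2
      simp only [h1, h2, map_neg, inner_neg_left, inner_neg_right]
      ring)
    (fun W hxW hyW => by
      have hxa := hxW.smul hsx.le
      have hya := hyW.smul hsy.le
      have hη : fderiv ℝ (flux F) p ((sy - sx) • B W) = (sy - sx) • W := by
        rw [map_smul, hB]
      have h1 := ((hQyj _ hya).sub (hQxj _ hxa)).sub (hF.hasJet_dualNorm hp1 hd hη)
      have h2 : ⟪p, sy • W⟫ - ⟪p, sx • W⟫ - ⟪p, (sy - sx) • W⟫ = 0 := by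
        simp only [inner_smul_right]
        ring
      rw [h2] at h1
      have h3 := h1.second_nonpos (by
        filter_upwards [hxa.filter_mono (nhdsWithin_mono _ Ioi_subset_Ici_self),
          hya.filter_mono (nhdsWithin_mono _ Ioi_subset_Ici_self)] with t h4 h5
        have := hmax' _ h4 _ h5
        simp only [zero_smul, add_zero, hp]
        rw [show y - x + t • (sy - sx) • W = y + t • sy • W - (x + t • sx • W) by module]
        exact this)
      rw [hQxs, hQys] at h3
      refine le_of_eq_of_le ?_ h3
      simp only [inner_smul_left, inner_smul_right, conj_trivial]
      ring)
  obtain ⟨W, η, hη, hηW, hW⟩ := hF.exists_frame hp0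
  have hBη : ∀ i, B (W i) = η i := fun i =>
    hF.fderiv_flux_injective hp0 (by rw [hB, hη])
  have hsum : sy ^ 2 * ((k - 1) / sy) - sx ^ 2 * ((k - 1) / sx) -
      (sy - sx) ^ 2 * ((n : ℝ) - 1) / d ≤ 0 := by
    have h1 := Finset.sum_nonpos fun i (_ : i ∈ Finset.univ) => key (W i)
    simp only [hBη, hηW] at h1
    rw [Finset.sum_sub_distrib, Finset.sum_sub_distrib, ← Finset.mul_sum, ← Finset.mul_sum,
      hQxf W hW, hQyf W hW, ← Finset.sum_div, ← Finset.mul_sum, Finset.sum_sub_distrib,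
      hF.sum_inner_frame_sq hp0 hW, hp1] at h1
    simpa using h1
  have hs : 0 < sy - sx := by linarith
  have h1 : sy ^ 2 * ((k - 1) / sy) - sx ^ 2 * ((k - 1) / sx) = (sy - sx) * (k - 1) := by
    field_simp
  rw [h1, sub_nonpos, le_div_iff₀ hd] at hsum
  have h2 : (k - 1) * d ≤ (sy - sx) * (n - 1) := by
    refine le_of_mul_le_mul_left ?_ hs
    linarith
  have h3 := hlip x hx y hy
  rw [← hsxdef, ← hsydef, ← hddef] at h3
  have h4 : (0 : ℝ) ≤ n - 1 := by
    have : (1 : ℝ) ≤ n := by exact_mod_cast hn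
    linarith
  have h5 := mul_le_mul_of_nonneg_right h3 h4
  have h6 := mul_lt_mul_of_pos_right hρ hd
  linarith

end

section

variable {n : ℕ} {F : EuclideanSpace ℝ (Fin n) → ℝ} {Ω K : Set (EuclideanSpace ℝ (Fin n))}
  {lam : ℝ} {u : EuclideanSpace ℝ (Fin n) → ℝ}
  {G : EuclideanSpace ℝ (Fin n) → EuclideanSpace ℝ (Fin n)}
  {H : EuclideanSpace ℝ (Fin n) → EuclideanSpace ℝ (Fin n) →L[ℝ] EuclideanSpace ℝ (Fin n)}
  {k S m ε : ℝ} {φ : ℝ → ℝ}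

lemma IsRegularEigenfunction.exists_lipschitz (h : IsRegularEigenfunction F K lam u G H)
    (hF : IsStronglyConvexMinkowskiNormC3 F) (hK : IsCompact K) (hconv : Convex ℝ K) :
    ∃ C > 0, ∀ x ∈ K, ∀ y ∈ K, |u y - u x| ≤ C * dualNorm F (y - x) := by
  obtain ⟨M, hM⟩ := hK.exists_bound_of_continuousOn h.continuousOn
  obtain ⟨c, hc, _, _, hN⟩ := hF.isMinkowskiNorm_dualNorm.exists_bounds
  refine ⟨max M 1 / c, div_pos (lt_max_of_lt_right one_pos) hc, fun x hx y hy => ?_⟩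
  have h1 := hconv.norm_image_sub_le_of_norm_hasFDerivWithin_le h.hasGradient
    (C := max M 1) (fun z hz => by
      rw [innerSL_apply_norm]
      exact (hM z hz).trans (le_max_left _ _)) hx hy
  rw [Real.norm_eq_abs] at h1
  refine h1.trans ?_
  rw [div_mul_eq_mul_div, le_div_iff₀ hc]
  nlinarith [(hN (y - x)).1, le_max_right M 1]

lemma mul_mem_Ioo_modelSol (hm0 : 0 ≤ m) (hm : m < modelSol lam k S) (hε : ε ∈ Ico 0 1)
    {τ : ℝ} (hτ : τ ∈ Icc (-1) m) : ε * τ ∈ Ioo (-1) (modelSol lam k S) := by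
  obtain ⟨h0, h1⟩ := hε
  obtain ⟨h2, h3⟩ := hτ
  constructor
  · nlinarith
  · nlinarith

lemma IsProfile.eventually_sub_le (hφ : IsProfile lam k S φ) (hm0 : 0 ≤ m)
    (hm : m < modelSol lam k S) (hε : ε ∈ Ico 0 1) {δ : ℝ} (hδ : 0 < δ) :
    ∀ᶠ ε' in 𝓝 ε, ε' ∈ Ico 0 1 → ∀ τ ∈ Icc (-1) m, ∀ σ ∈ Icc (-1) m,
      φ (ε' * σ) - φ (ε * σ) - (φ (ε' * τ) - φ (ε * τ)) ≤ δ * |σ - τ| := by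
  have h1 : ∀ᶠ ε' in 𝓝 ε, ∀ τ ∈ Icc (-1) m,
      |(modelDeriv lam k (φ (ε' * τ)))⁻¹ * ε' - (modelDeriv lam k (φ (ε * τ)))⁻¹ * ε| < δ := by
    refine isCompact_Icc.eventually_forall_of_forall_eventually fun τ hτ => ?_
    have h2 := (hφ.hasDerivAt_inv (mul_mem_Ioo_modelSol hm0 hm hε hτ)).continuousAt
    have h3 : ContinuousAt (fun z : ℝ × ℝ => (modelDeriv lam k (φ (z.1 * z.2)))⁻¹ * z.1)
        (ε, τ) := by
      refine ContinuousAt.mul ?_ continuousAt_fst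
      exact ContinuousAt.comp (f := fun z : ℝ × ℝ => z.1 * z.2) (x := (ε, τ)) h2 (by fun_prop)
    have h4 : ContinuousAt (fun z : ℝ × ℝ => (modelDeriv lam k (φ (ε * z.2)))⁻¹ * ε)
        (ε, τ) := by
      refine ContinuousAt.mul ?_ continuousAt_const
      exact ContinuousAt.comp (f := fun z : ℝ × ℝ => ε * z.2) (x := (ε, τ)) h2 (by fun_prop)
    have h5 := (h3.sub h4).abs
    refine h5.eventually_lt_const ?_
    simpa using hδ
  filter_upwards [h1] with ε' h2 hε' τ hτ σ hσ
  have h3 := (convex_Icc (-1) m).norm_image_sub_le_of_norm_hasDerivWithin_le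
    (f := fun τ => φ (ε' * τ) - φ (ε * τ))
    (f' := fun τ => (modelDeriv lam k (φ (ε' * τ)))⁻¹ * ε' - (modelDeriv lam k (φ (ε * τ)))⁻¹ * ε)
    (C := δ) (fun τ hτ => ?_) (fun τ hτ => (h2 τ hτ).le) hτ hσ
  · exact (le_abs_self _).trans h3
  · have h4 := (hφ.hasDerivAt _ (mul_mem_Ioo_modelSol hm0 hm hε' hτ)).comp τ
      ((hasDerivAt_id τ).const_mul ε')
    have h5 := (hφ.hasDerivAt _ (mul_mem_Ioo_modelSol hm0 hm hε hτ)).comp τ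
      ((hasDerivAt_id τ).const_mul ε)
    rw [mul_one] at h4 h5
    exact (h4.sub h5).hasDerivWithinAt

/-- The gradient comparison in integrated form. -/
lemma IsProfile.lipschitz (hn : 1 ≤ n) (hnk : n < k)
    (hφ : IsProfile lam k S φ) (hF : IsStronglyConvexMinkowskiNormC3 F) (hne : Ω.Nonempty)
    (hbd : Bornology.IsBounded Ω) (hop : IsOpen Ω) (hconv : Convex ℝ Ω)
    (hsb : HasSmoothBoundary Ω) (h : IsRegularEigenfunction F (closure Ω) lam u G H)
    (hm0 : 0 ≤ m) (hm : m < modelSol lam k S) (hum : ∀ x ∈ closure Ω, u x ∈ Icc (-1) m)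
    (hε : ε ∈ Ico 0 1) :
    ∀ x ∈ closure Ω, ∀ y ∈ closure Ω, φ (ε * u y) - φ (ε * u x) ≤ dualNorm F (y - x) := by
  have hN := hF.isMinkowskiNorm_dualNorm
  obtain ⟨C, hC, hlip⟩ := h.exists_lipschitz hF hbd.isCompact_closure hconv.closure
  have hn' : (1 : ℝ) ≤ n := by exact_mod_cast hn
  set s : Set ℝ := {ε | ∀ x ∈ closure Ω, ∀ y ∈ closure Ω,
    φ (ε * u y) - φ (ε * u x) ≤ dualNorm F (y - x)} with hs
  have hIco : ∀ {ε'}, ε' ∈ Icc 0 ε → ε' ∈ Ico (0 : ℝ) 1 := fun hε' =>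
    ⟨hε'.1, hε'.2.trans_lt hε.2⟩
  suffices Icc 0 ε ⊆ s from this (right_mem_Icc.2 hε.1)
  refine IsClosed.Icc_subset_of_forall_exists_gt ?_ ?_ ?_
  · refine IsSeqClosed.isClosed fun a l ha hl => ?_
    have hl' : l ∈ Icc 0 ε :=
      isClosed_Icc.mem_of_tendsto hl (Eventually.of_forall fun j => (ha j).2)
    refine ⟨fun x hx y hy => ?_, hl'⟩
    have h1 : ∀ z ∈ closure Ω, Tendsto (fun j => φ (a j * u z)) atTop (𝓝 (φ (l * u z))) :=
      fun z hz => (hφ.hasDerivAt _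
        (mul_mem_Ioo_modelSol hm0 hm (hIco hl') (hum z hz))).continuousAt.tendsto.comp
          (hl.mul_const _)
    exact le_of_tendsto ((h1 y hy).sub (h1 x hx)) (Eventually.of_forall fun j => (ha j).1 x hx y hy)
  · intro x _ y _
    simpa using hN.nonneg (y - x)
  · rintro ε₁ ⟨h1, h2⟩ ε₂ h3
    have hρ : 0 < (k - n) / (2 * n) := div_pos (by linarith) (by linarith)
    have h4 := hφ.eventually_sub_le hm0 hm (hIco ⟨h2.1, h2.2.le⟩) (div_pos hρ hC)
    obtain ⟨ε', h5, h6⟩ := ((h4.filter_mono nhdsWithin_le_nhds).and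
      (Ioo_mem_nhdsGT (lt_min h3 h2.2))).exists
    have h7 : ε' < ε₂ := h6.2.trans_le (min_le_left _ _)
    have h8 : ε' < ε := h6.2.trans_le (min_le_right _ _)
    have h9 : 0 < ε' := h2.1.trans_lt h6.1
    have hIco' := hIco ⟨h9.le, h8.le⟩
    refine ⟨ε', ?_, h6.1, h7.le⟩
    refine hφ.lipschitz_improve hn hF hne hbd hop hconv hsb h h9
      (fun x hx => mul_mem_Ioo_modelSol hm0 hm hIco' (hum x hx)) (ρ := 1 + (k - n) / (2 * n)) ?_ ?_
    · have : (n - 1) * ((k - n) / (2 * n)) ≤ (k - n) / 2 := by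
        rw [mul_div_assoc', div_le_div_iff₀ (by linarith) two_pos]
        nlinarith
      linarith
    · intro x hx y hy
      have h10 := h5 hIco' _ (hum x hx) _ (hum y hy)
      have h11 := h1 x hx y hy
      have h12 := mul_le_mul_of_nonneg_left (hlip x hx y hy) (div_pos hρ hC).le
      rw [← mul_assoc, div_mul_cancel₀ _ hC.ne'] at h12
      linarith

/-- An eigenfunction lies below the model solution centred at a minimum point. -/
lemma IsProfile.le_modelSol (hn : 1 ≤ n) (hnk : n < k)
    (hφ : IsProfile lam k S φ) (hF : IsStronglyConvexMinkowskiNormC3 F) (hne : Ω.Nonempty)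
    (hbd : Bornology.IsBounded Ω) (hop : IsOpen Ω) (hconv : Convex ℝ Ω)
    (hsb : HasSmoothBoundary Ω) (h : IsRegularEigenfunction F (closure Ω) lam u G H)
    (hm0 : 0 ≤ m) (hm : m < modelSol lam k S) (hum : ∀ x ∈ closure Ω, u x ∈ Icc (-1) m)
    {x₀ x : EuclideanSpace ℝ (Fin n)} (hx₀ : x₀ ∈ closure Ω) (hux₀ : u x₀ = -1)
    (hx : x ∈ closure Ω) {s : ℝ} (hs : dualNorm F (x - x₀) ≤ s) (hsS : s ≤ S) :
    u x ≤ modelSol lam k s := by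
  have hmem : ∀ {z}, z ∈ closure Ω → u z ∈ Icc (-1) (modelSol lam k S) := fun hz =>
    ⟨(hum _ hz).1, (hum _ hz).2.trans hm.le⟩
  have h1 : ∀ z ∈ closure Ω, Tendsto (fun ε => φ (ε * u z)) (𝓝[<] 1) (𝓝 (φ (u z))) := by
    intro z hz
    refine (hφ.continuousOn _ (hmem hz)).tendsto.comp (tendsto_nhdsWithin_iff.2 ⟨?_, ?_⟩)
    · have : Continuous fun ε : ℝ => ε * u z := by fun_prop
      simpa using (this.tendsto 1).mono_left nhdsWithin_le_nhds
    · filter_upwards [Ioo_mem_nhdsLT (zero_lt_one' ℝ)] with ε hε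
      exact Ioo_subset_Icc_self (mul_mem_Ioo_modelSol hm0 hm ⟨hε.1.le, hε.2⟩ (hum z hz))
  have h2 : φ (u x) - φ (u x₀) ≤ dualNorm F (x - x₀) := by
    refine le_of_tendsto ((h1 x hx).sub (h1 x₀ hx₀)) ?_
    filter_upwards [Ioo_mem_nhdsLT (zero_lt_one' ℝ)] with ε hε
    exact hφ.lipschitz hn hnk hF hne hbd hop hconv hsb h hm0 hm hum ⟨hε.1.le, hε.2⟩ x₀ hx₀ x hx
  have h3 : φ (u x₀) = 0 := by
    rw [hux₀, ← modelSol_zero lam k]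
    exact hφ.apply_modelSol 0 (left_mem_Icc.2 hφ.pos.le)
  have hmono : StrictMonoOn (modelSol lam k) (Icc 0 S) := by
    refine strictMonoOn_of_deriv_pos (convex_Icc _ _)
      (continuous_modelSol hφ.one_le).continuousOn fun s hs => ?_
    rw [interior_Icc] at hs
    rw [(hasDerivAt_modelSol hφ.one_le s).deriv]
    exact hφ.deriv_pos s ⟨hs.1, hs.2.le⟩
  rw [h3, sub_zero] at h2
  have h4 := hmono.monotoneOn (hφ.mem_Icc _ (hmem hx))
    ⟨(hF.isMinkowskiNorm_dualNorm.nonneg _).trans hs, hsS⟩ (h2.trans hs)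
  rwa [hφ.modelSol_apply _ (hmem hx)] at h4

end

section

variable {n : ℕ} {F : EuclideanSpace ℝ (Fin n) → ℝ} {Ω : Set (EuclideanSpace ℝ (Fin n))}
  {lam : ℝ} {u : EuclideanSpace ℝ (Fin n) → ℝ}
  {G : EuclideanSpace ℝ (Fin n) → EuclideanSpace ℝ (Fin n)}
  {H : EuclideanSpace ℝ (Fin n) → EuclideanSpace ℝ (Fin n) →L[ℝ] EuclideanSpace ℝ (Fin n)}

/-- Some minimum point is a limit of interior noncritical points. -/
lemma IsRegularEigenfunction.exists_mem_closure (h : IsRegularEigenfunction F (closure Ω) lam u G H)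
    (hconv : Convex ℝ Ω) (hnc : ¬ ∃ c : ℝ, ∀ x ∈ closure Ω, u x = c) {c : ℝ}
    (hc : ∃ x ∈ closure Ω, u x = c) :
    ∃ x ∈ closure Ω, u x = c ∧ x ∈ closure {y ∈ Ω | G y ≠ 0} := by
  by_contra! hcon
  have hG : ∀ z ∈ closure Ω, z ∉ closure {y ∈ Ω | G y ≠ 0} → G z = 0 := by
    intro z hz hzP
    by_contra hGz
    have h1 := eventually_nhdsWithin_iff.1 ((h.continuousOn z hz).eventually_ne hGz)
    refine hzP (mem_closure_iff_frequently.2 ?_)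
    exact ((mem_closure_iff_frequently.1 hz).and_eventually h1).mono
      fun y hy => ⟨hy.1, hy.2 (subset_closure hy.1)⟩
  have huc : ContinuousOn u (closure Ω) := fun x hx => (h.hasGradient x hx).continuousWithinAt
  have : PreconnectedSpace (closure Ω) :=
    isPreconnected_iff_preconnectedSpace.1 hconv.closure.isPreconnected
  have hclopen : IsClopen {x : closure Ω | u x = c} := by
    refine ⟨isClosed_eq (continuousOn_iff_continuous_domRestrict.1 huc) continuous_const,
      isOpen_iff_mem_nhds.2 fun x hx => ?_⟩
    have h1 : (closure {y ∈ Ω | G y ≠ 0})ᶜ ∈ 𝓝 (x : EuclideanSpace ℝ (Fin n)) :=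
      isClosed_closure.isOpen_compl.mem_nhds (hcon x x.2 hx)
    obtain ⟨r, hr, hball⟩ := Metric.mem_nhds_iff.1 h1
    refine (preimage_coe_mem_nhds_subtype (t := {x | u x = c})).2 ?_
    filter_upwards [self_mem_nhdsWithin, nhdsWithin_le_nhds (Metric.ball_mem_nhds _ hr)]
      with y hy hyr
    have h2 := (hconv.closure.inter (convex_ball (x : EuclideanSpace ℝ (Fin n)) r)
      ).norm_image_sub_le_of_norm_hasFDerivWithin_le (C := 0)
      (fun z hz => (h.hasGradient z hz.1).mono inter_subset_left) (fun z hz => by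
        rw [innerSL_apply_norm, hG z hz.1 (hball hz.2), norm_zero])
      ⟨x.2, Metric.mem_ball_self hr⟩ ⟨hy, hyr⟩
    rw [zero_mul, norm_le_zero_iff, sub_eq_zero] at h2
    exact h2.trans hx
  obtain ⟨x, hx, hxc⟩ := hc
  have huniv := hclopen.eq_univ ⟨⟨x, hx⟩, hxc⟩
  exact hnc ⟨c, fun y hy => (huniv.symm ▸ mem_univ (⟨y, hy⟩ : closure Ω) :
    (⟨y, hy⟩ : closure Ω) ∈ {x : closure Ω | u x = c})⟩

/-- Where `-lam * u` exceeds `κ * n`, an eigenfunction grows at least quadratically away from an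
interior noncritical point. -/
lemma IsRegularEigenfunction.exists_quadratic_growth
    (h : IsRegularEigenfunction F (closure Ω) lam u G H)
    (hF : IsStronglyConvexMinkowskiNormC3 F) (hbd : Bornology.IsBounded Ω) (hop : IsOpen Ω)
    (hconv : Convex ℝ Ω) {κ r : ℝ} (hκ : 0 < κ) (hr : 0 < r)
    {x₁ : EuclideanSpace ℝ (Fin n)} (hx₁ : x₁ ∈ Ω) (hGx₁ : G x₁ ≠ 0)
    (hκu : ∀ x ∈ closure Ω, dualNorm F (x - x₁) ≤ r → κ * n < -lam * u x) :
    ∃ x ∈ closure Ω, dualNorm F (x - x₁) = r ∧ u x₁ + κ / 2 * r ^ 2 ≤ u x := by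
  have hN := hF.isMinkowskiNorm_dualNorm
  have hx₁K := subset_closure hx₁
  have hNc : Continuous fun x => dualNorm F (x - x₁) :=
    hN.continuous.comp (continuous_id.sub continuous_const)
  have huc : ContinuousOn u (closure Ω) := fun x hx => (h.hasGradient x hx).continuousWithinAt
  obtain ⟨x, ⟨hx, hxr⟩, hmax⟩ :=
    (hbd.isCompact_closure.inter_right (isClosed_le hNc continuous_const)).exists_isMaxOn
      (f := fun x => u x - κ / 2 * dualNorm F (x - x₁) ^ 2)
      ⟨x₁, hx₁K, by simpa [hN.map_zero] using hr.le⟩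
      ((huc.mono inter_subset_left).sub (continuousOn_const.mul (hNc.continuousOn.pow 2)))
  have hmax' : ∀ y ∈ closure Ω, dualNorm F (y - x₁) ≤ r → u y - κ / 2 * dualNorm F (y - x₁) ^ 2 ≤
      u x - κ / 2 * dualNorm F (x - x₁) ^ 2 := fun y hy hyr => hmax ⟨hy, hyr⟩
  have hxr' : dualNorm F (x - x₁) ≤ r := hxr
  suffices hxr2 : dualNorm F (x - x₁) = r by
    refine ⟨x, hx, hxr2, ?_⟩
    have h1 := hmax' x₁ hx₁K (by rw [sub_self, hN.map_zero]; exact hr.le)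
    rw [sub_self, hN.map_zero, hxr2] at h1
    linarith
  by_contra hne'
  have hlt : dualNorm F (x - x₁) < r := hxr'.lt_of_ne hne'
  have hloc : ∀ W, IsAdmissible (closure Ω) x W → ∀ᶠ t : ℝ in 𝓝[>] 0,
      u (x + t • W) - κ / 2 * dualNorm F (x - x₁ + t • W) ^ 2 ≤
        u x - κ / 2 * dualNorm F (x - x₁) ^ 2 := by
    intro W hW
    have h1 : Tendsto (fun t : ℝ => dualNorm F (x - x₁ + t • W)) (𝓝[>] 0)
        (𝓝 (dualNorm F (x - x₁))) := by
      have h2 : Continuous fun t : ℝ => dualNorm F (x - x₁ + t • W) :=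
        hN.continuous.comp (by fun_prop)
      simpa using (h2.tendsto 0).mono_left nhdsWithin_le_nhds
    filter_upwards [h1.eventually (gt_mem_nhds hlt),
      hW.filter_mono (nhdsWithin_mono _ Ioi_subset_Ici_self)] with t h3 h4
    have h5 : x + t • W - x₁ = x - x₁ + t • W := by abel
    have h6 := hmax' _ h4 (by rw [h5]; exact h3.le)
    rwa [h5] at h6
  rcases eq_or_ne x x₁ with rfl | hxx₁
  · have hW := isAdmissible_of_mem (W := G x) hop hx₁
    have h1 : HasDerivWithinAt (fun t : ℝ => κ / 2 * (t ^ 2 * dualNorm F (G x) ^ 2)) 0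
        (Ici 0) 0 := by
      have := (((hasDerivAt_id (0 : ℝ)).pow 2).mul_const (dualNorm F (G x) ^ 2)).const_mul (κ / 2)
      simpa using this.hasDerivWithinAt
    have h2 := ((h.hasDerivWithinAt_zero hW).sub h1).nonpos_of_eventually_le (by
      filter_upwards [hloc _ hW] with t ht
      simp only [sub_self, zero_add, hN.map_zero, hF.dualNorm_smul, mul_pow, sq_abs] at ht
      simpa using ht)
    rw [sub_zero, real_inner_self_nonpos] at h2
    exact hGx₁ h2
  · have hd : 0 < dualNorm F (x - x₁) := hN.pos _ (sub_ne_zero.2 hxx₁)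
    set d := dualNorm F (x - x₁) with hddef
    obtain ⟨p, hp1, hp⟩ : ∃ p, F p = 1 ∧ d • flux F p = x - x₁ := hF.exists_unit_flux hd
    have hp0 : p ≠ 0 := by
      rintro rfl
      rw [hF.map_zero] at hp1
      exact zero_ne_one hp1
    have hjet : ∀ {W η}, fderiv ℝ (flux F) p η = W →
        HasJet (fun t => κ / 2 * dualNorm F (x - x₁ + t • W) ^ 2) (κ * d * ⟪p, W⟫)
          (κ * ⟪η, W⟫) := by
      intro W η hη
      have h1 := (hF.hasJet_dualNorm hp1 hd hη).comp (φ := fun a => κ / 2 * a ^ 2)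
        (φ' := fun a => κ * a) (φ₂ := κ)
        (Eventually.of_forall fun a => (((hasDerivAt_id a).pow 2).const_mul (κ / 2)).congr_deriv
          (by simp; ring))
        (by simpa using (hasDerivAt_id _).const_mul κ)
      simp only [zero_smul, add_zero, hp, ← hddef] at h1
      convert h1 using 1
      field_simp
      ring
    obtain ⟨W, η, hη, hηW, hW⟩ := hF.exists_frame hp0
    have hν : IsOutwardNormal (closure Ω) x (G x - (κ * d) • p) := by
      intro y hy
      have hadm := isAdmissible_sub hconv.closure hx hy
      obtain ⟨B, hB⟩ := hF.exists_rightInverse_fderiv_flux hp0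
      have h1 := ((h.hasDerivWithinAt_zero hadm).sub (hjet (hB (y - x))).hasDerivWithinAt
        ).nonpos_of_eventually_le (by
          filter_upwards [hloc _ hadm] with t ht
          simpa using ht)
      rwa [inner_sub_left, inner_smul_left, conj_trivial]
    have hflux : flux F ((κ * d) • p) = κ • (x - x₁) := by
      rw [hF.flux_smul, mul_smul, hp]
    have hν0 := hF.eq_zero_of_inner_flux (p := (κ * d) • p)
      (smul_ne_zero (mul_pos hκ hd).ne' hp0) (by
        have h1 := hν x₁ hx₁K
        rw [← neg_sub x, inner_neg_right, neg_nonpos, real_inner_comm] at h1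
        rw [hflux, inner_smul_left, conj_trivial]
        exact mul_nonneg hκ.le h1)
      (by rw [add_sub_cancel, h.inner_normal x hx _ hν])
    have hGx : G x = (κ * d) • p := sub_eq_zero.1 hν0
    have hG0 : G x ≠ 0 := by
      rw [hGx]
      exact smul_ne_zero (mul_pos hκ hd).ne' hp0
    by_cases hxΩ : x ∈ Ω
    · have h1 : ∀ i, ⟪H x (W i), W i⟫ - κ * ⟪η i, W i⟫ ≤ 0 := by
        intro i
        have hadm := isAdmissible_of_mem (W := W i) hop hxΩ
        have h2 := (h.hasJet hx hG0 hadm).sub (hjet (hη i))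
        rw [hGx, inner_smul_left, conj_trivial, sub_self] at h2
        exact h2.second_nonpos (by
          filter_upwards [hloc _ hadm] with t ht
          simpa using ht)
      have h2 := Finset.sum_nonpos fun i (_ : i ∈ Finset.univ) => h1 i
      have h3 : ∀ i j, aCoeff F i j p = aCoeff F i j (G x) := fun i j => by
        rw [hGx, hF.aCoeff_smul hp0 (mul_pos hκ hd).ne']
      rw [Finset.sum_sub_distrib, hW (H x)] at h2
      simp only [h3, hηW] at h2
      rw [h.eqn x hx hG0] at h2
      have h4 := hκu x hx hxr'
      simp at h2
      linarith
    · obtain ⟨ν, hν0, hν⟩ := exists_isOutwardNormal ⟨x₁, hx₁⟩ hop hconv hxΩ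
      refine hν0 (IsOutwardNormal.eq_zero hop hx₁ fun y hy => ?_)
      have h1 := h.inner_normal x hx ν hν
      rw [hGx, hflux, inner_smul_left, conj_trivial, mul_eq_zero, or_iff_right hκ.ne',
        real_inner_comm] at h1
      have h2 := hν y hy
      rw [show y - x₁ = y - x + (x - x₁) by abel, inner_add_right, h1, add_zero]
      exact h2

end

section

variable {n : ℕ} {F : EuclideanSpace ℝ (Fin n) → ℝ} {Ω : Set (EuclideanSpace ℝ (Fin n))}
  {lam : ℝ} {u : EuclideanSpace ℝ (Fin n) → ℝ}
  {G : EuclideanSpace ℝ (Fin n) → EuclideanSpace ℝ (Fin n)}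
  {H : EuclideanSpace ℝ (Fin n) → EuclideanSpace ℝ (Fin n) →L[ℝ] EuclideanSpace ℝ (Fin n)}

/-- A model solution of dimension larger than `n` that increases on `[0, S]` cannot exceed the
maximum of an eigenfunction there. -/
lemma IsRegularEigenfunction.modelSol_le (h : IsRegularEigenfunction F (closure Ω) lam u G H)
    (hn : 1 ≤ n) (hF : IsStronglyConvexMinkowskiNormC3 F)
    (hbd : Bornology.IsBounded Ω) (hop : IsOpen Ω) (hconv : Convex ℝ Ω)
    (hsb : HasSmoothBoundary Ω) (hlam : 0 < lam)
    (hnc : ¬ ∃ c : ℝ, ∀ x ∈ closure Ω, u x = c) (hmin : ∃ x ∈ closure Ω, u x = -1)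
    {m k S : ℝ} (hm0 : 0 ≤ m) (hum : ∀ x ∈ closure Ω, u x ∈ Icc (-1) m) (hnk : n < k)
    (hS : 0 < S) (hpos : ∀ s ∈ Ioc 0 S, 0 < modelDeriv lam k s) : modelSol lam k S ≤ m := by
  by_contra! hm
  have hN := hF.isMinkowskiNorm_dualNorm
  have hn' : (1 : ℝ) ≤ n := by exact_mod_cast hn
  have hk : 1 ≤ k := hn'.trans hnk.le
  obtain ⟨φ, hφ⟩ := exists_isProfile hk hS hpos
  obtain ⟨x₀, hx₀, hux₀, hx₀P⟩ := h.exists_mem_closure hconv hnc hmin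
  obtain ⟨κ, hκk, hκn⟩ := exists_between (div_lt_div_of_pos_left hlam (by linarith) hnk)
  have hκ : 0 < κ := (div_pos hlam (by linarith)).trans hκk
  obtain ⟨r₀, hr₀, hr₀V⟩ := exists_modelSol_lt hk hκk
  obtain ⟨δ, hδ, hδu⟩ : ∃ δ > 0, ∀ x ∈ closure Ω, dualNorm F (x - x₀) < δ →
      κ * n < -lam * u x := by
    obtain ⟨c, hc, _, _, hcN⟩ := hN.exists_bounds
    have h1 : ContinuousWithinAt (fun x => -lam * u x) (closure Ω) x₀ :=
      (h.hasGradient x₀ hx₀).continuousWithinAt.const_mul _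
    have h2 : κ * n < -lam * u x₀ := by
      rw [hux₀, mul_neg_one, neg_neg]
      exact (lt_div_iff₀ (by linarith)).1 hκn
    obtain ⟨δ, hδ, hball⟩ := Metric.mem_nhdsWithin_iff.1 (h1.eventually_const_lt h2)
    refine ⟨c * δ, mul_pos hc hδ, fun x hx hxδ => hball ⟨?_, hx⟩⟩
    rw [Metric.mem_ball, dist_eq_norm]
    exact lt_of_mul_lt_mul_left ((hcN _).1.trans_lt hxδ) hc.le
  obtain ⟨r, hr, hr2⟩ := exists_between (lt_min (lt_min hr₀ (half_pos hδ)) (half_pos hS))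
  have hrr₀ : r < r₀ := hr2.trans_le ((min_le_left _ _).trans (min_le_left _ _))
  have hrδ : r < δ / 2 := hr2.trans_le ((min_le_left _ _).trans (min_le_right _ _))
  have hrS : r < S / 2 := hr2.trans_le (min_le_right _ _)
  have hNc : Continuous fun x => dualNorm F (x - x₀) :=
    hN.continuous.comp (continuous_id.sub continuous_const)
  have hlt : ∀ᶠ x in 𝓝 x₀, modelSol lam k (r + dualNorm F (x - x₀)) < -1 + κ / 2 * r ^ 2 := by
    refine (((continuous_modelSol hk).comp
      (continuous_const.add hNc)).tendsto x₀).eventually_lt_const ?_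
    simpa [hN.map_zero] using hr₀V r ⟨hr, hrr₀⟩
  have hsmall : ∀ᶠ x in 𝓝 x₀, dualNorm F (x - x₀) < r :=
    (hNc.tendsto x₀).eventually_lt_const (by simpa [hN.map_zero] using hr)
  obtain ⟨x₁, ⟨hx₁, hGx₁⟩, h1, h2⟩ :=
    ((mem_closure_iff_frequently.1 hx₀P).and_eventually (hlt.and hsmall)).exists
  have htri : ∀ x, dualNorm F (x - x₀) ≤ dualNorm F (x - x₁) + dualNorm F (x₁ - x₀) := fun x => by
    simpa using hN.add_le (x - x₁) (x₁ - x₀)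
  obtain ⟨x, hx, hxr, hux⟩ := h.exists_quadratic_growth hF hbd hop hconv hκ hr hx₁ hGx₁
    fun x hx hxr => hδu x hx (by linarith [htri x])
  have h3 := hφ.le_modelSol hn hnk hF ⟨x₁, hx₁⟩ hbd hop hconv hsb h hm0 hm hum hx₀ hux₀ hx
    (s := r + dualNorm F (x₁ - x₀)) (by rw [← hxr]; exact htri x) (by linarith)
  have h4 := (hum x₁ (subset_closure hx₁)).1
  linarith

lemma nonneg_of_setIntegral_eq_zero (hne : Ω.Nonempty) (hbd : Bornology.IsBounded Ω)
    (hop : IsOpen Ω) (huc : ContinuousOn u (closure Ω)) (hmean : ∫ x in Ω, u x = 0) {m : ℝ}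
    (hm : ∀ x ∈ closure Ω, u x ≤ m) : 0 ≤ m := by
  have hfin := hbd.measure_lt_top (μ := MeasureTheory.volume)
  have hpos := hop.measure_pos MeasureTheory.volume hne
  have h1 : MeasureTheory.IntegrableOn u Ω :=
    (huc.integrableOn_compact hbd.isCompact_closure).mono_set subset_closure
  have h2 := MeasureTheory.setIntegral_mono_on h1
    (MeasureTheory.integrableOn_const hfin.ne (C := m)) hop.measurableSet
    fun x hx => hm x (subset_closure hx)
  rw [hmean, MeasureTheory.setIntegral_const, smul_eq_mul] at h2
  exact nonneg_of_mul_nonneg_right h2 (ENNReal.toReal_pos hpos.ne' hfin.ne)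

end

end Auxiliary

/-- Comparison of maxima with the one-dimensional model: if `v` solves
`v'' + ((n−1)/t)v' + λv = 0` on `(0,b)` with `v(0) = −1`, `v'(0⁺) = 0`, `v' > 0`
and `v'(b) = 0`, and the Neumann eigenfunction `u` has minimum `−1`, then
`max u ≥ v(b)`. -/
theorem max_comparison {n : ℕ} (hn : 1 ≤ n)
    (Ω : Set (EuclideanSpace ℝ (Fin n))) (hne : Ω.Nonempty)
    (hbd : Bornology.IsBounded Ω) (hop : IsOpen Ω) (hconv : Convex ℝ Ω)
    (hsb : HasSmoothBoundary Ω)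
    (F : EuclideanSpace ℝ (Fin n) → ℝ) (hF : IsStronglyConvexMinkowskiNormC3 F)
    (lam : ℝ) (hlam : 0 < lam)
    (u : EuclideanSpace ℝ (Fin n) → ℝ)
    (hu : IsNeumannEigenfunction F Ω lam u)
    (hnc : ¬ ∃ c : ℝ, ∀ x ∈ closure Ω, u x = c)
    (hmean : ∫ x in Ω, u x = 0)
    (hmin : (∀ x ∈ closure Ω, -1 ≤ u x) ∧ ∃ x ∈ closure Ω, u x = -1)
    (b : ℝ) (hb : 0 < b) (v : ℝ → ℝ)
    (hvcont : ContinuousOn v (Set.Icc 0 b))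
    (hvC2 : ContDiffOn ℝ 2 v (Set.Ioo 0 b))
    (hode : ∀ t ∈ Set.Ioo 0 b,
      deriv (deriv v) t + (((n : ℝ) - 1) / t) * deriv v t + lam * v t = 0)
    (hv0 : v 0 = -1)
    (hv'0 : Filter.Tendsto (deriv v) (nhdsWithin 0 (Set.Ioi 0)) (nhds 0))
    (hv' : ∀ t ∈ Set.Ioo 0 b, 0 < deriv v t)
    (hvb : deriv v b = 0) :
    ∃ x ∈ closure Ω, v b ≤ u x := by
  have huc : ContinuousOn u (closure Ω) := hu.contDiff1.continuousOn
  obtain ⟨x, hx, hmax⟩ := hbd.isCompact_closure.exists_isMaxOn hne.closure huc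
  refine ⟨x, hx, ?_⟩
  by_contra! hlt
  obtain ⟨G, H, h⟩ := hu.exists_isRegularEigenfunction hF hne hop hconv
  obtain ⟨k, S, hnk, hS, hpos, hVS⟩ :=
    exists_modelSol_gt hn hlam hb hvcont hvC2 hode hv0 hv'0 hv' hlt
  refine hVS.not_ge (h.modelSol_le hn hF hbd hop hconv hsb hlam hnc hmin.2 ?_
    (fun y hy => ⟨hmin.1 y hy, hmax hy⟩) hnk hS hpos)
  exact nonneg_of_setIntegral_eq_zero hne hbd hop huc hmean fun y hy => hmax hy
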